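/- arXiv:math/0511420 — 6 statements merged into one kernel-verified Lean document; each statement's English description precedes it below -/
import Mathlib

section
/- Let n ≥ 3 and let T be a vertex of the Whitehouse complex Δ_n (so T ⊆ {2,…,n} with 2 ≤ |T| ≤ n−2). Then the link of T in Δ_n is isomorphic, as a simplicial complex, to the join Δ_{|T|+1} * Δ_{n−|T|+1} of a copy of the Whitehouse complex Δ_{|T|+1} and a copy of the Whitehouse complex Δ_{n−|T|+1} on disjoint vertex sets. -/
/-- `F` is a face of the Whitehouse complex `Δ_n`. -/
def IsWhFace (n : ℕ) (F : Finset (Finset ℕ)) : Prop :=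
  (∀ S ∈ F, S ⊆ Finset.Icc 2 n ∧ 2 ≤ S.card ∧ S.card ≤ n - 2) ∧
  ∀ S ∈ F, ∀ T ∈ F, S ⊆ T ∨ T ⊆ S ∨ S ∩ T = ∅

/-- A face of the join `Δ_m * Δ_k` of two Whitehouse complexes, realized on the
disjoint union (sum type) of two copies of the respective vertex sets. -/
def IsWhJoinFace (m k : ℕ) (G : Finset (Finset ℕ ⊕ Finset ℕ)) : Prop :=
  ∃ F₁ F₂ : Finset (Finset ℕ), IsWhFace m F₁ ∧ IsWhFace k F₂ ∧
    G = F₁.image Sum.inl ∪ F₂.image Sum.inr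

/-- Nested or disjoint: the compatibility relation of the Whitehouse complex. -/
def WhCompat (S T : Finset ℕ) : Prop := S ⊆ T ∨ T ⊆ S ∨ S ∩ T = ∅

/-- `S` is a vertex of the Whitehouse complex `Δ_n`. -/
def IsWhVertex (n : ℕ) (S : Finset ℕ) : Prop :=
  S ⊆ Finset.Icc 2 n ∧ 2 ≤ S.card ∧ S.card ≤ n - 2

lemma whCompat_self (S : Finset ℕ) : WhCompat S S := Or.inl subset_rfl

lemma WhCompat.symm {S T : Finset ℕ} (h : WhCompat S T) : WhCompat T S := by
  rcases h with h | h | h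
  · exact Or.inr (Or.inl h)
  · exact Or.inl h
  · exact Or.inr (Or.inr (by rwa [Finset.inter_comm]))

lemma isWhFace_iff {n : ℕ} {F : Finset (Finset ℕ)} :
    IsWhFace n F ↔ (∀ S ∈ F, IsWhVertex n S) ∧ ∀ S ∈ F, ∀ T ∈ F, WhCompat S T :=
  Iff.rfl

lemma isWhFace_empty (n : ℕ) : IsWhFace n ∅ := by simp [IsWhFace]

lemma isWhFace_singleton {n : ℕ} {S : Finset ℕ} : IsWhFace n {S} ↔ IsWhVertex n S := by
  simp [isWhFace_iff, whCompat_self]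

lemma isWhFace_insert {n : ℕ} {T : Finset ℕ} {F : Finset (Finset ℕ)} :
    IsWhFace n (insert T F) ↔ IsWhVertex n T ∧ (∀ S ∈ F, WhCompat S T) ∧ IsWhFace n F := by
  simp only [isWhFace_iff, Finset.forall_mem_insert]
  constructor
  · rintro ⟨⟨hT, hF⟩, -, h⟩
    exact ⟨hT, fun S hS => (h S hS).1, hF, fun S hS => (h S hS).2⟩
  · rintro ⟨hT, hTF, hF, h⟩
    exact ⟨⟨hT, hF⟩, ⟨whCompat_self T, fun S hS => (hTF S hS).symm⟩,
      fun S hS => ⟨hTF S hS, h S hS⟩⟩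

lemma isWhFace_pair {n : ℕ} {S T : Finset ℕ} :
    IsWhFace n {S, T} ↔ IsWhVertex n S ∧ IsWhVertex n T ∧ WhCompat S T := by
  rw [isWhFace_insert, isWhFace_singleton]
  simp only [Finset.mem_singleton, forall_eq]
  exact ⟨fun h => ⟨h.1, h.2.2, h.2.1.symm⟩, fun h => ⟨h.1, h.2.2.symm, h.2.1⟩⟩

lemma isWhJoinFace_iff {m k : ℕ} {G : Finset (Finset ℕ ⊕ Finset ℕ)} :
    IsWhJoinFace m k G ↔ IsWhFace m G.toLeft ∧ IsWhFace k G.toRight := by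
  constructor
  · rintro ⟨F₁, F₂, h₁, h₂, rfl⟩
    have hl : (F₁.image Sum.inl ∪ F₂.image Sum.inr : Finset (Finset ℕ ⊕ Finset ℕ)).toLeft =
        F₁ := by
      ext; simp
    have hr : (F₁.image Sum.inl ∪ F₂.image Sum.inr : Finset (Finset ℕ ⊕ Finset ℕ)).toRight =
        F₂ := by
      ext; simp
    rw [hl, hr]
    exact ⟨h₁, h₂⟩
  · rintro ⟨h₁, h₂⟩
    refine ⟨_, _, h₁, h₂, ?_⟩
    ext (S | S) <;> simp

lemma isWhJoinFace_singleton_inl {m k : ℕ} {S : Finset ℕ} :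
    IsWhJoinFace m k {Sum.inl S} ↔ IsWhVertex m S := by
  have hl : ({Sum.inl S} : Finset (Finset ℕ ⊕ Finset ℕ)).toLeft = {S} := by ext; simp
  have hr : ({Sum.inl S} : Finset (Finset ℕ ⊕ Finset ℕ)).toRight = ∅ := by ext; simp
  rw [isWhJoinFace_iff, hl, hr, isWhFace_singleton, and_iff_left (isWhFace_empty k)]

lemma isWhJoinFace_singleton_inr {m k : ℕ} {S : Finset ℕ} :
    IsWhJoinFace m k {Sum.inr S} ↔ IsWhVertex k S := by
  have hl : ({Sum.inr S} : Finset (Finset ℕ ⊕ Finset ℕ)).toLeft = ∅ := by ext; simp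
  have hr : ({Sum.inr S} : Finset (Finset ℕ ⊕ Finset ℕ)).toRight = {S} := by ext; simp
  rw [isWhJoinFace_iff, hl, hr, isWhFace_singleton, and_iff_right (isWhFace_empty m)]

lemma whCompat_image_iff {f : ℕ → ℕ} {A S T : Finset ℕ} (hf : Set.InjOn f A) (hS : S ⊆ A)
    (hT : T ⊆ A) : WhCompat (S.image f) (T.image f) ↔ WhCompat S T := by
  unfold WhCompat
  rw [Finset.image_subset_image_iff_of_injOn hf hS hT,
    Finset.image_subset_image_iff_of_injOn hf hT hS,
    ← Finset.image_inter_of_injOn, Finset.image_eq_empty]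
  exact hf.mono (by simpa using And.intro hS hT)

lemma Finset.exists_injOn_image_eq {α β : Type*} [Nonempty β] [DecidableEq β] {A : Finset α}
    {B : Finset β} (h : A.card = B.card) : ∃ f : α → β, Set.InjOn f A ∧ A.image f = B := by
  obtain ⟨f, hf⟩ := A.finite_toSet.exists_bijOn_of_encard_eq (t := (B : Set β)) (by simp [h])
  exact ⟨f, hf.injOn, by rw [← Finset.coe_inj, Finset.coe_image, hf.image_eq]⟩

/-- `S` is a vertex of the link of `T` in `Δ_n`. -/
def IsWhLinkVertex (n : ℕ) (T S : Finset ℕ) : Prop :=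
  S ≠ T ∧ IsWhVertex n S ∧ WhCompat S T

/-- The representatives `({2, …, n} \ T) ∪ {a}` of the set obtained from `{2, …, n}` by
contracting `T` to its element `a`. -/
def whContract (n : ℕ) (T : Finset ℕ) (a : ℕ) : Finset ℕ := insert a (Finset.Icc 2 n \ T)

section Link

variable {n a : ℕ} {T S S' : Finset ℕ}

lemma card_whContract (hT : IsWhVertex n T) (ha : a ∈ T) :
    (whContract n T a).card = n - T.card := by
  have := Finset.card_sdiff_of_subset hT.1
  have := hT.2
  rw [whContract, Finset.card_insert_of_notMem (by simp [ha])]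
  simp_all
  omega

lemma inter_whContract_of_inter_eq_empty (hS : IsWhVertex n S) (h : S ∩ T = ∅) :
    S ∩ whContract n T a = S := by
  rw [Finset.inter_eq_left]
  intro x hx
  have := hS.1 hx
  have : x ∉ T := fun hxT => by simpa [h] using Finset.mem_inter.2 ⟨hx, hxT⟩
  simp_all [whContract]

lemma inter_whContract_of_subset (hS : IsWhVertex n S) (ha : a ∈ T) (h : T ⊆ S) :
    S ∩ whContract n T a = insert a (S \ T) := by
  ext x
  have := @hS.1 x
  have := @h a
  simp only [whContract, Finset.mem_inter, Finset.mem_insert, Finset.mem_sdiff]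
  grind

lemma IsWhLinkVertex.not_subset_cases (hS : IsWhLinkVertex n T S) (h : ¬ S ⊆ T) :
    T ⊆ S ∨ S ∩ T = ∅ :=
  hS.2.2.resolve_left h

lemma IsWhLinkVertex.card_inter_whContract (hT : IsWhVertex n T) (ha : a ∈ T)
    (hS : IsWhLinkVertex n T S) (h : ¬ S ⊆ T) :
    2 ≤ (S ∩ whContract n T a).card ∧ (S ∩ whContract n T a).card ≤ n - T.card - 1 := by
  have hTc := hT.2
  have hSc := hS.2.1.2
  rcases hS.not_subset_cases h with h' | h'
  · rw [inter_whContract_of_subset hS.2.1 ha h', Finset.card_insert_of_notMem (by simp [ha])]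
    have := Finset.card_sdiff_add_card_eq_card h'
    have := Finset.card_lt_card (Finset.ssubset_iff_subset_ne.2 ⟨h', hS.1.symm⟩)
    omega
  · rw [inter_whContract_of_inter_eq_empty hS.2.1 h']
    have := Finset.card_union_of_disjoint (Finset.disjoint_iff_inter_eq_empty.2 h')
    have h2 := Finset.card_le_card (Finset.union_subset hS.2.1.1 hT.1)
    simp only [Nat.card_Icc] at h2
    omega

lemma IsWhLinkVertex.inter_whContract_subset_iff (ha : a ∈ T) (hS : IsWhLinkVertex n T S)
    (hS' : IsWhLinkVertex n T S') (h : ¬ S ⊆ T) (h' : ¬ S' ⊆ T) :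
    S ∩ whContract n T a ⊆ S' ∩ whContract n T a ↔ S ⊆ S' := by
  refine ⟨fun hsub x hx => ?_, fun hsub => Finset.inter_subset_inter_right hsub⟩
  have hxn := hS.2.1.1 hx
  by_cases hxT : x ∈ T
  · have hTS : T ⊆ S := (hS.not_subset_cases h).resolve_right fun h0 => by
      simpa [h0] using Finset.mem_inter.2 ⟨hx, hxT⟩
    have haS' := (Finset.mem_inter.1 (hsub (Finset.mem_inter.2
      ⟨hTS ha, Finset.mem_insert_self _ _⟩))).1
    have hTS' : T ⊆ S' := (hS'.not_subset_cases h').resolve_right fun h0 => by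
      simpa [h0] using Finset.mem_inter.2 ⟨haS', ha⟩
    exact hTS' hxT
  · exact (Finset.mem_inter.1 (hsub (Finset.mem_inter.2
      ⟨hx, Finset.mem_insert_of_mem (Finset.mem_sdiff.2 ⟨hxn, hxT⟩)⟩))).1

lemma IsWhLinkVertex.whCompat_inter_whContract_iff (ha : a ∈ T) (hS : IsWhLinkVertex n T S)
    (hS' : IsWhLinkVertex n T S') (h : ¬ S ⊆ T) (h' : ¬ S' ⊆ T) :
    WhCompat (S ∩ whContract n T a) (S' ∩ whContract n T a) ↔ WhCompat S S' := by
  unfold WhCompat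
  rw [hS.inter_whContract_subset_iff ha hS' h h', hS'.inter_whContract_subset_iff ha hS h' h]
  refine or_congr_right (or_congr_right ?_)
  rw [← Finset.inter_inter_distrib_right]
  refine ⟨fun h0 => ?_, fun h0 => by simp [h0]⟩
  rcases hS.not_subset_cases h with hTS | hST
  · rcases hS'.not_subset_cases h' with hTS' | hST'
    · have : a ∈ S ∩ S' ∩ whContract n T a := by simp [hTS ha, hTS' ha, whContract]
      simp [h0] at this
    · rwa [Finset.inter_assoc, inter_whContract_of_inter_eq_empty hS'.2.1 hST'] at h0
  · rwa [Finset.inter_right_comm, inter_whContract_of_inter_eq_empty hS.2.1 hST] at h0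

lemma IsWhLinkVertex.whCompat_of_subset_of_not_subset (hS : IsWhLinkVertex n T S)
    (h : ¬ S ⊆ T) (h' : S' ⊆ T) : WhCompat S S' := by
  rcases hS.not_subset_cases h with hTS | hST
  · exact Or.inr (Or.inl (h'.trans hTS))
  · exact Or.inr (Or.inr (Finset.subset_empty.1 (hST ▸ Finset.inter_subset_inter_left h')))

lemma exists_isWhLinkVertex_inter_whContract_eq (hT : IsWhVertex n T) (ha : a ∈ T)
    {B : Finset ℕ} (hB : B ⊆ whContract n T a) (hB2 : 2 ≤ B.card)
    (hBn : B.card ≤ n - T.card - 1) :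
    ∃ S, IsWhLinkVertex n T S ∧ ¬ S ⊆ T ∧ S ∩ whContract n T a = B := by
  have hTc := hT.2
  have hB' : ∀ x ∈ B, x = a ∨ x ∈ Finset.Icc 2 n ∧ x ∉ T := fun x hx => by
    simpa [whContract] using hB hx
  by_cases haB : a ∈ B
  · have hnot : ¬ B ∪ T ⊆ T := fun hsub => by
      have : B ⊆ {a} := fun x hx => by
        have := hsub (Finset.mem_union_left _ hx)
        have := hB' x hx
        simp; tauto
      have := Finset.card_le_card this
      simp at this
      omega
    have hint : B ∩ T = {a} := by
      ext x
      have := hB' x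
      simp only [Finset.mem_inter, Finset.mem_singleton]
      grind
    have hcard := Finset.card_union_add_card_inter B T
    rw [hint, Finset.card_singleton] at hcard
    refine ⟨B ∪ T, ⟨fun h0 => hnot h0.subset, ⟨?_, by omega, by omega⟩,
      Or.inr (Or.inl Finset.subset_union_right)⟩, hnot, ?_⟩
    · refine Finset.union_subset (fun x hx => ?_) hT.1
      rcases hB' x hx with rfl | h0
      · exact hT.1 ha
      · exact h0.1
    · ext x
      have := hB' x
      simp only [whContract, Finset.mem_inter, Finset.mem_union, Finset.mem_insert,
        Finset.mem_sdiff]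
      grind
  · have hBd : ∀ x ∈ B, x ∈ Finset.Icc 2 n ∧ x ∉ T := fun x hx =>
      (hB' x hx).resolve_left fun h0 => haB (h0 ▸ hx)
    have hdis : B ∩ T = ∅ := by
      ext x
      have := hBd x
      simp only [Finset.mem_inter, Finset.notMem_empty]
      tauto
    have hnot : ¬ B ⊆ T := fun hsub => by
      rw [Finset.inter_eq_left.2 hsub] at hdis
      simp [hdis] at hB2
    exact ⟨B, ⟨fun h0 => hnot h0.subset, ⟨fun x hx => (hBd x hx).1, hB2, by omega⟩,
      Or.inr (Or.inr hdis)⟩, hnot, Finset.inter_eq_left.2 hB⟩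

end Link

/-- The vertex map from the link of `T` to the join: subsets of `T` are relabelled by `f`, the
other vertices are contracted and relabelled by `g`. -/
def whLinkMap (n : ℕ) (T : Finset ℕ) (a : ℕ) (f g : ℕ → ℕ) (S : Finset ℕ) :
    Finset ℕ ⊕ Finset ℕ :=
  if S ⊆ T then Sum.inl (S.image f) else Sum.inr ((S ∩ whContract n T a).image g)

section LinkMap

variable {n a : ℕ} {T : Finset ℕ} {f g : ℕ → ℕ}

lemma bijOn_whLinkMap (hT : IsWhVertex n T) (ha : a ∈ T) (hf : Set.InjOn f T)
    (hfT : T.image f = Finset.Icc 2 (T.card + 1)) (hg : Set.InjOn g (whContract n T a))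
    (hgT : (whContract n T a).image g = Finset.Icc 2 (n - T.card + 1)) :
    Set.BijOn (whLinkMap n T a f g) {S | IsWhLinkVertex n T S}
      {v | IsWhJoinFace (T.card + 1) (n - T.card + 1) {v}} := by
  refine ⟨fun S hS => ?_, fun S hS S' hS' heq => ?_, ?_⟩
  · simp only [Set.mem_ofPred_eq, whLinkMap] at hS ⊢
    split_ifs with h
    · rw [isWhJoinFace_singleton_inl]
      refine ⟨hfT ▸ Finset.image_subset_image h, ?_⟩
      rw [Finset.card_image_of_injOn (hf.mono (by exact_mod_cast h))]
      have := Finset.card_lt_card (Finset.ssubset_iff_subset_ne.2 ⟨h, hS.1⟩)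
      have := hS.2.1.2
      omega
    · rw [isWhJoinFace_singleton_inr]
      refine ⟨hgT ▸ Finset.image_subset_image Finset.inter_subset_right, ?_⟩
      rw [Finset.card_image_of_injOn (hg.mono (by exact_mod_cast Finset.inter_subset_right))]
      have := hS.card_inter_whContract hT ha h
      omega
  · simp only [Set.mem_ofPred_eq, whLinkMap] at hS hS' heq
    split_ifs at heq with h h' h'
    · exact (Finset.image_eq_image_iff_of_injOn hf h h').1 (Sum.inl_injective heq)
    · have := (Finset.image_eq_image_iff_of_injOn hg Finset.inter_subset_right
        Finset.inter_subset_right).1 (Sum.inr_injective heq)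
      exact ((hS.inter_whContract_subset_iff ha hS' h h').1 this.subset).antisymm
        ((hS'.inter_whContract_subset_iff ha hS h' h).1 this.superset)
  · rintro (A | B) hv
    · rw [Set.mem_ofPred_eq, isWhJoinFace_singleton_inl] at hv
      obtain ⟨hA, hA2, hAn⟩ := hv
      obtain ⟨S, hS, rfl⟩ := Finset.subset_image_iff.1 (hfT ▸ hA)
      have hS' : S ⊆ T := by exact_mod_cast hS
      rw [Finset.card_image_of_injOn (hf.mono hS)] at hA2 hAn
      have := hT.2
      refine ⟨S, ⟨?_, ⟨hS'.trans hT.1, hA2, by omega⟩, Or.inl hS'⟩, by simp [whLinkMap, hS']⟩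
      rintro rfl
      omega
    · rw [Set.mem_ofPred_eq, isWhJoinFace_singleton_inr] at hv
      obtain ⟨hB, hB2, hBn⟩ := hv
      obtain ⟨B, hBU, rfl⟩ := Finset.subset_image_iff.1 (hgT ▸ hB)
      rw [Finset.card_image_of_injOn (hg.mono hBU)] at hB2 hBn
      obtain ⟨S, hS, hST, rfl⟩ := exists_isWhLinkVertex_inter_whContract_eq hT ha
        (by exact_mod_cast hBU) hB2 (by omega)
      exact ⟨S, hS, by simp [whLinkMap, hST]⟩

lemma isWhJoinFace_image_whLinkMap_iff (hT : IsWhVertex n T) (ha : a ∈ T) (hf : Set.InjOn f T)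
    (hfT : T.image f = Finset.Icc 2 (T.card + 1)) (hg : Set.InjOn g (whContract n T a))
    (hgT : (whContract n T a).image g = Finset.Icc 2 (n - T.card + 1))
    {G : Finset (Finset ℕ)} (hG : ∀ S ∈ G, IsWhLinkVertex n T S) :
    IsWhJoinFace (T.card + 1) (n - T.card + 1) (G.image (whLinkMap n T a f g)) ↔
      IsWhFace n G := by
  have hvert : ∀ S ∈ G, IsWhJoinFace (T.card + 1) (n - T.card + 1) {whLinkMap n T a f g S} :=
    fun S hS => (bijOn_whLinkMap hT ha hf hfT hg hgT).mapsTo (hG S hS)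
  rw [isWhJoinFace_iff]
  simp only [isWhFace_iff, Finset.mem_toLeft, Finset.mem_toRight]
  constructor
  · rintro ⟨⟨-, hl⟩, -, hr⟩
    refine ⟨fun S hS => (hG S hS).2.1, fun S hS S' hS' => ?_⟩
    by_cases h : S ⊆ T <;> by_cases h' : S' ⊆ T
    · exact (whCompat_image_iff hf h h').1
        (hl _ (Finset.mem_image.2 ⟨S, hS, by simp [whLinkMap, h]⟩)
          _ (Finset.mem_image.2 ⟨S', hS', by simp [whLinkMap, h']⟩))
    · exact ((hG S' hS').whCompat_of_subset_of_not_subset h' h).symm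
    · exact (hG S hS).whCompat_of_subset_of_not_subset h h'
    · exact ((hG S hS).whCompat_inter_whContract_iff ha (hG S' hS') h h').1
        ((whCompat_image_iff hg Finset.inter_subset_right Finset.inter_subset_right).1
          (hr _ (Finset.mem_image.2 ⟨S, hS, by simp [whLinkMap, h]⟩)
            _ (Finset.mem_image.2 ⟨S', hS', by simp [whLinkMap, h']⟩)))
  · rintro ⟨-, hc⟩
    have hleft : ∀ S, whLinkMap n T a f g S = Sum.inl (S.image f) ∧ S ⊆ T ∨
        whLinkMap n T a f g S = Sum.inr ((S ∩ whContract n T a).image g) ∧ ¬ S ⊆ T := fun S => by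
      by_cases h : S ⊆ T <;> simp [whLinkMap, h]
    refine ⟨⟨fun A hA => ?_, fun A hA A' hA' => ?_⟩, fun A hA => ?_, fun A hA A' hA' => ?_⟩
    · obtain ⟨S, hS, hSA⟩ := Finset.mem_image.1 hA
      exact isWhJoinFace_singleton_inl.1 (hSA ▸ hvert S hS)
    · obtain ⟨S, hS, hSA⟩ := Finset.mem_image.1 hA
      obtain ⟨S', hS', hSA'⟩ := Finset.mem_image.1 hA'
      rcases hleft S with ⟨h, hST⟩ | ⟨h, -⟩ <;> rw [hSA] at h <;> cases h
      rcases hleft S' with ⟨h, hST'⟩ | ⟨h, -⟩ <;> rw [hSA'] at h <;> cases h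
      exact (whCompat_image_iff hf hST hST').2 (hc S hS S' hS')
    · obtain ⟨S, hS, hSA⟩ := Finset.mem_image.1 hA
      exact isWhJoinFace_singleton_inr.1 (hSA ▸ hvert S hS)
    · obtain ⟨S, hS, hSA⟩ := Finset.mem_image.1 hA
      obtain ⟨S', hS', hSA'⟩ := Finset.mem_image.1 hA'
      rcases hleft S with ⟨h, -⟩ | ⟨h, hST⟩ <;> rw [hSA] at h <;> cases h
      rcases hleft S' with ⟨h, -⟩ | ⟨h, hST'⟩ <;> rw [hSA'] at h <;> cases h
      exact (whCompat_image_iff hg Finset.inter_subset_right Finset.inter_subset_right).2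
        (((hG S hS).whCompat_inter_whContract_iff ha (hG S' hS') hST hST').2 (hc S hS S' hS'))

end LinkMap

theorem stmt1 (n : ℕ) (hn : 3 ≤ n) (T : Finset ℕ)
    (hT : T ⊆ Finset.Icc 2 n ∧ 2 ≤ T.card ∧ T.card ≤ n - 2) :
    ∃ φ : Finset ℕ → (Finset ℕ ⊕ Finset ℕ),
      Set.BijOn φ
        {S : Finset ℕ | S ≠ T ∧ IsWhFace n {S, T}}
        {v : Finset ℕ ⊕ Finset ℕ | IsWhJoinFace (T.card + 1) (n - T.card + 1) {v}} ∧
      ∀ G : Finset (Finset ℕ),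
        (∀ S ∈ G, S ≠ T ∧ IsWhFace n {S, T}) →
        ((T ∉ G ∧ IsWhFace n (insert T G)) ↔
          IsWhJoinFace (T.card + 1) (n - T.card + 1) (G.image φ)) := by
  have hT' : IsWhVertex n T := hT
  obtain ⟨a, ha⟩ : T.Nonempty := Finset.card_pos.1 (by omega)
  obtain ⟨f, hf, hfT⟩ := Finset.exists_injOn_image_eq (A := T)
    (B := Finset.Icc 2 (T.card + 1)) (by simp)
  obtain ⟨g, hg, hgT⟩ := Finset.exists_injOn_image_eq (A := whContract n T a)
    (B := Finset.Icc 2 (n - T.card + 1)) (by simp [card_whContract hT' ha])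
  have hlink : ∀ S, (S ≠ T ∧ IsWhFace n {S, T}) ↔ IsWhLinkVertex n T S := fun S => by
    rw [isWhFace_pair, IsWhLinkVertex, and_iff_right hT']
  simp only [hlink]
  refine ⟨whLinkMap n T a f g, bijOn_whLinkMap hT' ha hf hfT hg hgT, fun G hG => ?_⟩
  rw [isWhJoinFace_image_whLinkMap_iff hT' ha hf hfT hg hgT hG, isWhFace_insert,
    and_iff_right hT', and_iff_right fun S hS => (hG S hS).2.2,
    and_iff_right fun hTG => (hG T hTG).1 rfl]
end

section
/- For n ≥ 4, let f_{n,i} denote the number of faces of the Whitehouse complex Δ_n of dimension i (i.e., faces with exactly i+1 elements). Then f_{n,−1} = 1 and for all i with −1 ≤ i ≤ n−4, f_{n,i} = (i+2)·f_{n−1,i} + (n+i−1)·f_{n−1,i−1}. -/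
/-- `f_{n,i}`: the number of faces of the Whitehouse complex `Δ_n` of dimension `i`,
i.e. with exactly `i + 1` elements. -/
noncomputable def whf (n : ℕ) (i : ℤ) : ℕ :=
  Set.ncard {F : Finset (Finset ℕ) | IsWhFace n F ∧ (F.card : ℤ) = i + 1}

/-- `F` is a family of pairwise nested or disjoint subsets of `A`, each with at least two elements,
that contains `A` itself. Such families encode rooted trees with leaves labelled by `A`, a set
standing for the inner vertex whose descendant leaves it collects. -/
structure IsRootedLaminar {α : Type*} [DecidableEq α] (A : Finset α) (F : Finset (Finset α)) :
    Prop where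
  subset : ∀ S ∈ F, S ⊆ A
  two_le : ∀ S ∈ F, 2 ≤ S.card
  laminar : ∀ S ∈ F, ∀ T ∈ F, S ⊆ T ∨ T ⊆ S ∨ S ∩ T = ∅
  root_mem : A ∈ F

/-- The minimal member of `F` containing `x` is `insert x v`. -/
structure IsStem {α : Type*} [DecidableEq α] (x : α) (F : Finset (Finset α)) (v : Finset α) :
    Prop where
  insert_mem : insert x v ∈ F
  notMem : x ∉ v
  subset : ∀ S ∈ F, x ∈ S → v ⊆ S

/-- The family obtained by hanging the new leaf `x` on the edge above `v`. -/
def hangLeaf {α : Type*} [DecidableEq α] (x : α) (F : Finset (Finset α)) (v : Finset α) :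
    Finset (Finset α) :=
  insert (insert x v) (F.image fun T => if v ⊂ T then insert x T else T)

/-- The family obtained by deleting the leaf `x`. -/
def pruneLeaf {α : Type*} [DecidableEq α] (x : α) (F : Finset (Finset α)) : Finset (Finset α) :=
  (F.image fun S => S.erase x).filter fun S => 2 ≤ S.card

open Classical in
/-- The rooted laminar families on `A` with `k` members. -/
noncomputable def rootedLaminars {α : Type*} (A : Finset α) (k : ℕ) :
    Finset (Finset (Finset α)) :=
  A.powerset.powerset.filter fun F => IsRootedLaminar A F ∧ F.card = k

section

variable {α : Type*} [DecidableEq α] {A : Finset α} {F : Finset (Finset α)} {v w : Finset α} {x : α}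

theorem mem_rootedLaminars {k : ℕ} :
    F ∈ rootedLaminars A k ↔ IsRootedLaminar A F ∧ F.card = k := by
  have hd : (fun a b => Classical.propDecidable (a = b)) = ‹DecidableEq α› :=
    Subsingleton.elim _ _
  unfold rootedLaminars
  simp only [Finset.mem_filter, Finset.mem_powerset]
  rw [hd]
  refine ⟨fun h => h.2, fun h => ⟨fun S hS => ?_, h⟩⟩
  exact Finset.mem_powerset.2 (h.1.subset S hS)

theorem IsStem.eq (hv : IsStem x F v) (hw : IsStem x F w) : v = w := by
  have h1 := hv.subset _ hw.insert_mem (Finset.mem_insert_self _ _)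
  have h2 := hw.subset _ hv.insert_mem (Finset.mem_insert_self _ _)
  exact ((Finset.subset_insert_iff_of_notMem hv.notMem).1 h1).antisymm
    ((Finset.subset_insert_iff_of_notMem hw.notMem).1 h2)

theorem IsRootedLaminar.exists_isStem (hF : IsRootedLaminar (insert x A) F) :
    ∃ v, IsStem x F v := by
  obtain ⟨M, hM, hmin⟩ := (F.filter fun S => x ∈ S).exists_min_image Finset.card
    ⟨_, Finset.mem_filter.2 ⟨hF.root_mem, Finset.mem_insert_self _ _⟩⟩
  obtain ⟨hMF, hxM⟩ := Finset.mem_filter.1 hM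
  refine ⟨M.erase x, by rwa [Finset.insert_erase hxM], Finset.notMem_erase _ _, fun S hS hx => ?_⟩
  refine (Finset.erase_subset _ _).trans ?_
  rcases hF.laminar M hMF S hS with h | h | h
  · exact h
  · exact (Finset.eq_of_subset_of_card_le h (hmin S (Finset.mem_filter.2 ⟨hS, hx⟩))).ge
  · have := Finset.mem_inter.2 ⟨hxM, hx⟩
    simp [h] at this

theorem insert_mem_hangLeaf (hx : ∀ S ∈ F, x ∉ S) {T : Finset α} (hv : x ∉ v) (hT : x ∉ T) :
    insert x T ∈ hangLeaf x F v ↔ T = v ∨ T ∈ F ∧ v ⊂ T := by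
  have inj : ∀ {S : Finset α}, x ∉ S → insert x S = insert x T → S = T := fun hS h => by
    rw [← Finset.erase_insert hS, h, Finset.erase_insert hT]
  simp only [hangLeaf, Finset.mem_insert, Finset.mem_image]
  constructor
  · rintro (h | ⟨S, hS, h⟩)
    · exact Or.inl (inj hv h.symm).symm
    · split_ifs at h with hvS
      · exact Or.inr (inj (hx S hS) h ▸ ⟨hS, hvS⟩)
      · exact absurd (h ▸ Finset.mem_insert_self x T) (hx S hS)
  · rintro (rfl | ⟨h, h'⟩)
    · exact Or.inl rfl
    · exact Or.inr ⟨T, h, if_pos h'⟩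

theorem mem_hangLeaf_of_notMem {T : Finset α} (hT : x ∉ T) :
    T ∈ hangLeaf x F v ↔ T ∈ F ∧ ¬ v ⊂ T := by
  simp only [hangLeaf, Finset.mem_insert, Finset.mem_image]
  constructor
  · rintro (rfl | ⟨S, hS, rfl⟩)
    · simp at hT
    · split_ifs at hT ⊢ with hvS
      · simp at hT
      · exact ⟨hS, hvS⟩
  · rintro ⟨h, h'⟩
    exact Or.inr ⟨T, h, if_neg h'⟩

theorem card_hangLeaf (hx : ∀ S ∈ F, x ∉ S) (hv : x ∉ v) :
    (hangLeaf x F v).card = F.card + 1 := by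
  rw [hangLeaf, Finset.card_insert_of_notMem, Finset.card_image_of_injOn]
  · intro S hS T hT h
    have key : ∀ S ∈ F, (if v ⊂ S then insert x S else S).erase x = S := fun S hS => by
      split_ifs
      · exact Finset.erase_insert (hx S hS)
      · exact Finset.erase_eq_of_notMem (hx S hS)
    rw [← key S hS, ← key T hT]
    exact congrArg (Finset.erase · x) h
  · simp only [Finset.mem_image, not_exists, not_and]
    intro S hS h
    split_ifs at h with hvS
    · have : S = v := by rw [← Finset.erase_insert (hx S hS), h, Finset.erase_insert hv]
      exact hvS.ne this.symm
    · exact hx S hS (h ▸ Finset.mem_insert_self x v)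

theorem isStem_hangLeaf (hx : ∀ S ∈ F, x ∉ S) (hv : x ∉ v) : IsStem x (hangLeaf x F v) v where
  insert_mem := Finset.mem_insert_self _ _
  notMem := hv
  subset S hS hxS := by
    rw [← Finset.insert_erase hxS, insert_mem_hangLeaf hx hv (Finset.notMem_erase _ _)] at hS
    refine Finset.Subset.trans ?_ (Finset.erase_subset x S)
    rcases hS with h | h
    · exact h.ge
    · exact h.2.1

/-- The members of `F` together with the singletons of `A`: all vertices of the tree. -/
def treeVertices (A : Finset α) (F : Finset (Finset α)) : Finset (Finset α) :=
  F ∪ A.image fun a => {a}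

theorem mem_treeVertices : v ∈ treeVertices A F ↔ v ∈ F ∨ ∃ a ∈ A, {a} = v := by
  simp [treeVertices]

theorem IsRootedLaminar.card_treeVertices (hF : IsRootedLaminar A F) :
    (treeVertices A F).card = F.card + A.card := by
  rw [treeVertices, Finset.card_union_of_disjoint,
    Finset.card_image_of_injective _ Finset.singleton_injective]
  rw [Finset.disjoint_left]
  intro S hS h
  obtain ⟨a, -, rfl⟩ := Finset.mem_image.1 h
  simpa using hF.two_le _ hS

theorem IsRootedLaminar.subset_of_mem_treeVertices (hF : IsRootedLaminar A F)
    (hv : v ∈ treeVertices A F) : v ⊆ A := by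
  rcases mem_treeVertices.1 hv with h | ⟨a, ha, rfl⟩
  · exact hF.subset _ h
  · simpa using ha

theorem IsRootedLaminar.nonempty_of_mem_treeVertices (hF : IsRootedLaminar A F)
    (hv : v ∈ treeVertices A F) : v.Nonempty := by
  rcases mem_treeVertices.1 hv with h | ⟨a, ha, rfl⟩
  · exact Finset.card_pos.1 (by have := hF.two_le _ h; omega)
  · simp

theorem IsRootedLaminar.laminar_treeVertices (hF : IsRootedLaminar A F)
    (hv : v ∈ treeVertices A F) (hw : w ∈ F) : v ⊆ w ∨ w ⊆ v ∨ v ∩ w = ∅ := by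
  rcases mem_treeVertices.1 hv with h | ⟨a, ha, rfl⟩
  · exact hF.laminar _ h _ hw
  · by_cases haw : a ∈ w
    · exact Or.inl (by simpa using haw)
    · exact Or.inr (Or.inr (Finset.singleton_inter_of_notMem haw))

theorem IsRootedLaminar.notMem_of_mem (hF : IsRootedLaminar A F) (hxA : x ∉ A) :
    ∀ S ∈ F, x ∉ S := fun S hS h => hxA (hF.subset S hS h)

theorem IsRootedLaminar.hangLeaf (hF : IsRootedLaminar A F) (hxA : x ∉ A)
    (hv : v ∈ treeVertices A F) : IsRootedLaminar (insert x A) (hangLeaf x F v) := by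
  have hx := hF.notMem_of_mem hxA
  have hvA := hF.subset_of_mem_treeVertices hv
  have hxv : x ∉ v := fun h => hxA (hvA h)
  have hne := hF.nonempty_of_mem_treeVertices hv
  have hstem := isStem_hangLeaf hx hxv
  have cases_mem : ∀ S ∈ _root_.hangLeaf x F v, (x ∉ S ∧ S ∈ F ∧ ¬ v ⊂ S) ∨
      ∃ T, x ∉ T ∧ S = insert x T ∧ v ⊆ T ∧ (T = v ∨ T ∈ F) := by
    intro S hS
    by_cases hxS : x ∈ S
    · right
      have hS' := hS
      rw [← Finset.insert_erase hxS, insert_mem_hangLeaf hx hxv (Finset.notMem_erase _ _)] at hS'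
      refine ⟨S.erase x, Finset.notMem_erase _ _, (Finset.insert_erase hxS).symm, ?_, ?_⟩
      · rcases hS' with h | h
        · exact h.ge
        · exact h.2.1
      · exact hS'.imp id And.left
    · exact Or.inl ⟨hxS, (mem_hangLeaf_of_notMem hxS).1 hS⟩
  have mixed : ∀ S T, (x ∉ S ∧ S ∈ F ∧ ¬ v ⊂ S) → v ⊆ T → (T = v ∨ T ∈ F) →
      S ⊆ insert x T ∨ S ∩ insert x T = ∅ := by
    intro S T hS hvT hT
    have hlam : T ⊆ S ∨ S ⊆ T ∨ T ∩ S = ∅ := by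
      rcases hT with rfl | hT
      · exact hF.laminar_treeVertices hv hS.2.1
      · exact hF.laminar _ hT _ hS.2.1
    rcases hlam with h | h | h
    · have hvS : v = S := by
        by_contra hne
        exact hS.2.2 (Finset.ssubset_iff_subset_ne.2 ⟨hvT.trans h, hne⟩)
      exact Or.inl (hvS ▸ hvT.trans (Finset.subset_insert _ _))
    · exact Or.inl (h.trans (Finset.subset_insert _ _))
    · right
      rw [Finset.inter_comm, Finset.insert_inter_of_notMem hS.1, h]
  refine ⟨fun S hS => ?_, fun S hS => ?_, fun S hS T hT => ?_, ?_⟩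
  · rcases cases_mem S hS with h | ⟨T, -, rfl, -, rfl | hT⟩
    · exact (hF.subset _ h.2.1).trans (Finset.subset_insert _ _)
    · exact Finset.insert_subset_insert _ hvA
    · exact Finset.insert_subset_insert _ (hF.subset _ hT)
  · rcases cases_mem S hS with h | ⟨T, hxT, rfl, hvT, -⟩
    · exact hF.two_le _ h.2.1
    · rw [Finset.card_insert_of_notMem hxT]
      have := (hne.mono hvT).card_pos
      omega
  · rcases cases_mem S hS with h | ⟨S, hxS, rfl, hvS, hS'⟩ <;>
      rcases cases_mem T hT with h' | ⟨T, hxT, rfl, hvT, hT'⟩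
    · exact hF.laminar _ h.2.1 _ h'.2.1
    · rcases mixed S T h hvT hT' with h | h <;> simp [h]
    · rcases mixed T S h' hvS hS' with h | h
      · simp [h]
      · exact Or.inr (Or.inr (by rwa [Finset.inter_comm]))
    · rcases hS' with rfl | hS'
      · exact Or.inl (Finset.insert_subset_insert _ hvT)
      rcases hT' with rfl | hT'
      · exact Or.inr (Or.inl (Finset.insert_subset_insert _ hvS))
      rcases hF.laminar _ hS' _ hT' with h | h | h
      · exact Or.inl (Finset.insert_subset_insert _ h)
      · exact Or.inr (Or.inl (Finset.insert_subset_insert _ h))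
      · obtain ⟨a, ha⟩ := hne
        have := Finset.mem_inter.2 ⟨hvS ha, hvT ha⟩
        simp [h] at this
  · rw [insert_mem_hangLeaf hx hxv hxA]
    by_cases h : A = v
    · exact Or.inl h
    · exact Or.inr ⟨hF.root_mem, Finset.ssubset_iff_subset_ne.2 ⟨hvA, Ne.symm h⟩⟩

theorem mem_pruneLeaf {T : Finset α} :
    T ∈ pruneLeaf x F ↔ x ∉ T ∧ 2 ≤ T.card ∧ (T ∈ F ∨ insert x T ∈ F) := by
  simp only [pruneLeaf, Finset.mem_filter, Finset.mem_image]
  constructor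
  · rintro ⟨⟨S, hS, rfl⟩, h⟩
    refine ⟨Finset.notMem_erase _ _, h, ?_⟩
    by_cases hx : x ∈ S
    · exact Or.inr (by rwa [Finset.insert_erase hx])
    · exact Or.inl (by rwa [Finset.erase_eq_of_notMem hx])
  · rintro ⟨hx, h, hT | hT⟩
    · exact ⟨⟨T, hT, Finset.erase_eq_of_notMem hx⟩, h⟩
    · exact ⟨⟨_, hT, Finset.erase_insert hx⟩, h⟩

theorem IsRootedLaminar.pruneLeaf_hangLeaf (hF : IsRootedLaminar A F) (hxA : x ∉ A)
    (hv : v ∈ treeVertices A F) : pruneLeaf x (_root_.hangLeaf x F v) = F := by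
  have hx := hF.notMem_of_mem hxA
  have hxv : x ∉ v := fun h => hxA (hF.subset_of_mem_treeVertices hv h)
  ext T
  rw [mem_pruneLeaf]
  constructor
  · rintro ⟨hxT, hT2, hT | hT⟩
    · exact ((mem_hangLeaf_of_notMem hxT).1 hT).1
    · rcases (insert_mem_hangLeaf hx hxv hxT).1 hT with rfl | h
      · rcases mem_treeVertices.1 hv with h | ⟨a, -, rfl⟩
        · exact h
        · simp at hT2
      · exact h.1
  · intro hT
    refine ⟨hx T hT, hF.two_le T hT, ?_⟩
    rw [mem_hangLeaf_of_notMem (hx T hT), insert_mem_hangLeaf hx hxv (hx T hT)]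
    tauto

theorem IsRootedLaminar.pruneLeaf (hF : IsRootedLaminar (insert x A) F) (hxA : x ∉ A)
    (hA : 2 ≤ A.card) : IsRootedLaminar A (pruneLeaf x F) := by
  refine ⟨fun S hS => ?_, fun S hS => (mem_pruneLeaf.1 hS).2.1, fun S hS T hT => ?_,
    mem_pruneLeaf.2 ⟨hxA, hA, Or.inr hF.root_mem⟩⟩
  · obtain ⟨hxS, -, h | h⟩ := mem_pruneLeaf.1 hS
    · exact (Finset.subset_insert_iff_of_notMem hxS).1 (hF.subset _ h)
    · exact (Finset.subset_insert_iff_of_notMem hxS).1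
        ((Finset.subset_insert _ _).trans (hF.subset _ h))
  · simp only [_root_.pruneLeaf, Finset.mem_filter, Finset.mem_image] at hS hT
    obtain ⟨⟨S, hS, rfl⟩, -⟩ := hS
    obtain ⟨⟨T, hT, rfl⟩, -⟩ := hT
    rcases hF.laminar S hS T hT with h | h | h
    · exact Or.inl (Finset.erase_subset_erase _ h)
    · exact Or.inr (Or.inl (Finset.erase_subset_erase _ h))
    · refine Or.inr (Or.inr (Finset.subset_empty.1 ?_))
      rw [← h]
      exact Finset.inter_subset_inter (Finset.erase_subset _ _) (Finset.erase_subset _ _)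

theorem IsRootedLaminar.stem_nonempty (hF : IsRootedLaminar A F) (hv : IsStem x F v) :
    v.Nonempty := by
  have := hF.two_le _ hv.insert_mem
  rw [Finset.card_insert_of_notMem hv.notMem] at this
  exact Finset.card_pos.1 (by omega)

theorem IsRootedLaminar.laminar_stem (hF : IsRootedLaminar A F) (hv : IsStem x F v)
    {S : Finset α} (hS : S ∈ F) (hxS : x ∉ S) : S ⊆ v ∨ S ∩ v = ∅ := by
  rcases hF.laminar _ hS _ hv.insert_mem with h | h | h
  · exact Or.inl ((Finset.subset_insert_iff_of_notMem hxS).1 h)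
  · exact absurd (h (Finset.mem_insert_self _ _)) hxS
  · refine Or.inr (Finset.subset_empty.1 ?_)
    rw [← h]
    exact Finset.inter_subset_inter_left (Finset.subset_insert _ _)

theorem IsRootedLaminar.not_stem_ssubset (hF : IsRootedLaminar A F) (hv : IsStem x F v)
    {S : Finset α} (hS : S ∈ F) (hxS : x ∉ S) : ¬ v ⊂ S := fun hvS => by
  rcases hF.laminar_stem hv hS hxS with h | h
  · exact hvS.2 h
  · rw [Finset.inter_eq_right.2 hvS.1] at h
    exact (hF.stem_nonempty hv).ne_empty h

theorem IsRootedLaminar.stem_mem_treeVertices (hF : IsRootedLaminar (insert x A) F)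
    (hv : IsStem x F v) (hvF : v ∈ F ∨ v.card = 1) : v ∈ treeVertices A (_root_.pruneLeaf x F) := by
  rw [mem_treeVertices]
  rcases hvF with h | h
  · exact Or.inl (mem_pruneLeaf.2 ⟨hv.notMem, hF.two_le _ h, Or.inl h⟩)
  · obtain ⟨a, rfl⟩ := Finset.card_eq_one.1 h
    refine Or.inr ⟨a, ?_, rfl⟩
    have := hF.subset _ hv.insert_mem (Finset.mem_insert_of_mem (Finset.mem_singleton_self a))
    have hne : a ≠ x := fun h => hv.notMem (by simp [h])
    simpa [hne] using this

theorem IsRootedLaminar.hangLeaf_pruneLeaf (hF : IsRootedLaminar A F)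
    (hv : IsStem x F v) (hvF : v ∈ F ∨ v.card = 1) :
    _root_.hangLeaf x (_root_.pruneLeaf x F) v = F := by
  have hx : ∀ S ∈ _root_.pruneLeaf x F, x ∉ S := fun S hS => (mem_pruneLeaf.1 hS).1
  ext S
  by_cases hxS : x ∈ S
  · obtain ⟨T, hxT, rfl⟩ : ∃ T, x ∉ T ∧ S = insert x T :=
      ⟨S.erase x, Finset.notMem_erase _ _, (Finset.insert_erase hxS).symm⟩
    rw [insert_mem_hangLeaf hx hv.notMem hxT]
    constructor
    · rintro (rfl | ⟨hT, hvT⟩)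
      · exact hv.insert_mem
      · obtain ⟨-, -, h | h⟩ := mem_pruneLeaf.1 hT
        · exact absurd hvT (hF.not_stem_ssubset hv h hxT)
        · exact h
    · intro hS
      have hvT := (Finset.subset_insert_iff_of_notMem hv.notMem).1 (hv.subset _ hS hxS)
      by_cases h : T = v
      · exact Or.inl h
      · have hss : v ⊂ T := Finset.ssubset_iff_subset_ne.2 ⟨hvT, Ne.symm h⟩
        have h1 : 0 < v.card := (hF.stem_nonempty hv).card_pos
        have h2 := Finset.card_lt_card hss
        exact Or.inr ⟨mem_pruneLeaf.2 ⟨hxT, by omega, Or.inr hS⟩, hss⟩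
  · rw [mem_hangLeaf_of_notMem hxS]
    constructor
    · rintro ⟨hS, hvS⟩
      obtain ⟨-, h2, h | h⟩ := mem_pruneLeaf.1 hS
      · exact h
      · have hsub := (Finset.subset_insert_iff_of_notMem hv.notMem).1
          (hv.subset _ h (Finset.mem_insert_self _ _))
        have heq : v = S := by
          by_contra hne
          exact hvS (Finset.ssubset_iff_subset_ne.2 ⟨hsub, hne⟩)
        subst heq
        exact hvF.resolve_right (by omega)
    · intro hS
      exact ⟨mem_pruneLeaf.2 ⟨hxS, hF.two_le _ hS, Or.inl hS⟩, hF.not_stem_ssubset hv hS hxS⟩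

theorem IsRootedLaminar.insert_stem (hF : IsRootedLaminar A F) (hv : IsStem x F v)
    (hv2 : 2 ≤ v.card) : IsRootedLaminar A (insert v F) := by
  have key : ∀ S ∈ F, v ⊆ S ∨ S ⊆ v ∨ v ∩ S = ∅ := fun S hS => by
    by_cases hxS : x ∈ S
    · exact Or.inl (hv.subset S hS hxS)
    · rw [Finset.inter_comm]
      exact Or.inr (hF.laminar_stem hv hS hxS)
  refine ⟨?_, ?_, ?_, Finset.mem_insert_of_mem hF.root_mem⟩
  · rw [Finset.forall_mem_insert]
    exact ⟨(Finset.subset_insert x v).trans (hF.subset _ hv.insert_mem), hF.subset⟩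
  · rw [Finset.forall_mem_insert]
    exact ⟨hv2, hF.two_le⟩
  · intro S hS T hT
    rcases Finset.mem_insert.1 hS with hSv | hSF <;> rcases Finset.mem_insert.1 hT with hTv | hTF
    · exact Or.inl (hSv.trans hTv.symm).subset
    · exact hSv ▸ key T hTF
    · have := key S hSF
      rw [hTv]
      rw [Finset.inter_comm]
      tauto
    · exact hF.laminar S hSF T hTF

theorem IsStem.insert (hv : IsStem x F v) : IsStem x (insert v F) v where
  insert_mem := Finset.mem_insert_of_mem hv.insert_mem
  notMem := hv.notMem
  subset := by
    rw [Finset.forall_mem_insert]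
    exact ⟨fun _ => subset_rfl, hv.subset⟩

theorem IsStem.erase (hv : IsStem x F v) : IsStem x (F.erase v) v where
  insert_mem := Finset.mem_erase.2
    ⟨fun h => hv.notMem (h ▸ Finset.mem_insert_self x v), hv.insert_mem⟩
  notMem := hv.notMem
  subset S hS := hv.subset S (Finset.mem_of_mem_erase hS)

theorem IsRootedLaminar.erase (hF : IsRootedLaminar A F) (hv : v ≠ A) :
    IsRootedLaminar A (F.erase v) where
  subset S hS := hF.subset S (Finset.mem_of_mem_erase hS)
  two_le S hS := hF.two_le S (Finset.mem_of_mem_erase hS)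
  laminar S hS T hT := hF.laminar S (Finset.mem_of_mem_erase hS) T (Finset.mem_of_mem_erase hT)
  root_mem := Finset.mem_erase.2 ⟨hv.symm, hF.root_mem⟩

/-- Hanging `x` on an edge is a bijection onto the families whose stem is a tree vertex. -/
theorem card_rootedLaminars_edge (hxA : x ∉ A) (hA : 2 ≤ A.card) (k : ℕ)
    (P : Finset (Finset α) → Prop) [DecidablePred P]
    (hP : ∀ F v, IsStem x F v → (P F ↔ v ∈ F ∨ v.card = 1)) :
    ((rootedLaminars (insert x A) (k + 1)).filter P).card =
      (k + A.card) * (rootedLaminars A k).card := by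
  have hcard : ((rootedLaminars A k).sigma fun F => treeVertices A F).card =
      (k + A.card) * (rootedLaminars A k).card := by
    rw [Finset.card_sigma, Finset.sum_congr rfl (fun F hF => ?_), Finset.sum_const, smul_eq_mul,
      mul_comm]
    rw [mem_rootedLaminars] at hF
    rw [hF.1.card_treeVertices, hF.2]
  rw [← hcard]
  symm
  refine Finset.card_bij (fun p _ => hangLeaf x p.1 p.2) ?_ ?_ ?_
  · rintro ⟨F, v⟩ h
    obtain ⟨hF, hv⟩ := Finset.mem_sigma.1 h
    rw [mem_rootedLaminars] at hF
    have hx := hF.1.notMem_of_mem hxA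
    have hxv : x ∉ v := fun h => hxA (hF.1.subset_of_mem_treeVertices hv h)
    rw [Finset.mem_filter, mem_rootedLaminars, hP _ _ (isStem_hangLeaf hx hxv),
      card_hangLeaf hx hxv, hF.2, mem_hangLeaf_of_notMem hxv]
    refine ⟨⟨hF.1.hangLeaf hxA hv, rfl⟩, ?_⟩
    rcases mem_treeVertices.1 hv with h | ⟨a, -, h⟩
    · exact Or.inl ⟨h, fun h => h.2 subset_rfl⟩
    · exact Or.inr (by rw [← Finset.card_singleton a, h])
  · rintro ⟨F, v⟩ h ⟨G, w⟩ h' heq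
    obtain ⟨hF, hv⟩ := Finset.mem_sigma.1 h
    obtain ⟨hG, hw⟩ := Finset.mem_sigma.1 h'
    rw [mem_rootedLaminars] at hF hG
    dsimp only at heq hv hw hF hG
    have h1 := isStem_hangLeaf (hF.1.notMem_of_mem hxA)
      (fun h => hxA (hF.1.subset_of_mem_treeVertices hv h))
    have h2 := isStem_hangLeaf (hG.1.notMem_of_mem hxA)
      (fun h => hxA (hG.1.subset_of_mem_treeVertices hw h))
    obtain rfl : v = w := h1.eq (heq ▸ h2)
    obtain rfl : F = G := by
      rw [← hF.1.pruneLeaf_hangLeaf hxA hv, heq, hG.1.pruneLeaf_hangLeaf hxA hw]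
    rfl
  · intro G h
    rw [Finset.mem_filter, mem_rootedLaminars] at h
    obtain ⟨⟨hG, hk⟩, hPG⟩ := h
    obtain ⟨v, hv⟩ := hG.exists_isStem
    have hvG := (hP G v hv).1 hPG
    have heq := hG.hangLeaf_pruneLeaf hv hvG
    refine ⟨⟨pruneLeaf x G, v⟩, ?_, heq⟩
    refine Finset.mem_sigma.2 ⟨mem_rootedLaminars.2 ⟨hG.pruneLeaf hxA hA, ?_⟩,
      hG.stem_mem_treeVertices hv hvG⟩
    have := card_hangLeaf (F := pruneLeaf x G) (fun S hS => (mem_pruneLeaf.1 hS).1) hv.notMem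
    rw [heq, hk] at this
    exact (Nat.succ.inj this).symm

/-- Hanging `x` on an inner vertex is a bijection onto the families whose stem is not a tree
vertex. -/
theorem card_rootedLaminars_vertex (hxA : x ∉ A) (hA : 2 ≤ A.card) (k : ℕ)
    (P : Finset (Finset α) → Prop) [DecidablePred P]
    (hP : ∀ F v, IsStem x F v → (P F ↔ v ∈ F ∨ v.card = 1)) :
    ((rootedLaminars (insert x A) k).filter fun F => ¬ P F).card =
      k * (rootedLaminars A k).card := by
  have hcard : ((rootedLaminars A k).sigma fun F => F).card = k * (rootedLaminars A k).card := by
    rw [Finset.card_sigma, Finset.sum_congr rfl (fun F hF => (mem_rootedLaminars.1 hF).2),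
      Finset.sum_const, smul_eq_mul, mul_comm]
  rw [← hcard]
  symm
  have self_mem : ∀ {F v}, IsRootedLaminar A F → v ∈ F → v ∈ hangLeaf x F v := fun hF hv =>
    (mem_hangLeaf_of_notMem (hF.notMem_of_mem hxA _ hv)).2 ⟨hv, fun h => h.2 subset_rfl⟩
  refine Finset.card_bij (fun p _ => (hangLeaf x p.1 p.2).erase p.2) ?_ ?_ ?_
  · rintro ⟨F, v⟩ h
    obtain ⟨hF, hv⟩ := Finset.mem_sigma.1 h
    rw [mem_rootedLaminars] at hF
    dsimp only at hF hv
    have hx := hF.1.notMem_of_mem hxA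
    have hv2 := hF.1.two_le v hv
    rw [Finset.mem_filter, mem_rootedLaminars, hP _ _ (isStem_hangLeaf hx (hx v hv)).erase,
      Finset.card_erase_of_mem (self_mem hF.1 hv), card_hangLeaf hx (hx v hv), hF.2]
    refine ⟨⟨(hF.1.hangLeaf hxA (mem_treeVertices.2 (Or.inl hv))).erase ?_, rfl⟩, ?_⟩
    · rintro rfl
      exact hx _ hv (Finset.mem_insert_self x A)
    · simp only [Finset.notMem_erase, false_or]
      omega
  · rintro ⟨F, v⟩ h ⟨G, w⟩ h' heq
    obtain ⟨hF, hv⟩ := Finset.mem_sigma.1 h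
    obtain ⟨hG, hw⟩ := Finset.mem_sigma.1 h'
    rw [mem_rootedLaminars] at hF hG
    dsimp only at heq hv hw hF hG
    have hxF := hF.1.notMem_of_mem hxA
    have hxG := hG.1.notMem_of_mem hxA
    obtain rfl : v = w := (isStem_hangLeaf hxF (hxF v hv)).erase.eq
      (heq ▸ (isStem_hangLeaf hxG (hxG w hw)).erase)
    have heq' : hangLeaf x F v = hangLeaf x G v := by
      rw [← Finset.insert_erase (self_mem hF.1 hv), heq, Finset.insert_erase (self_mem hG.1 hw)]
    obtain rfl : F = G := by
      rw [← hF.1.pruneLeaf_hangLeaf hxA (mem_treeVertices.2 (Or.inl hv)), heq',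
        hG.1.pruneLeaf_hangLeaf hxA (mem_treeVertices.2 (Or.inl hw))]
    rfl
  · intro G h
    rw [Finset.mem_filter, mem_rootedLaminars] at h
    obtain ⟨⟨hG, hk⟩, hPG⟩ := h
    obtain ⟨v, hv⟩ := hG.exists_isStem
    rw [hP G v hv, not_or] at hPG
    have hv2 : 2 ≤ v.card := by
      have := (hG.stem_nonempty hv).card_pos
      omega
    have hG' := hG.insert_stem hv hv2
    have hvG := Finset.mem_insert_self v G
    have heq := hG'.hangLeaf_pruneLeaf hv.insert (Or.inl hvG)
    refine ⟨⟨pruneLeaf x (insert v G), v⟩, ?_, ?_⟩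
    · refine Finset.mem_sigma.2 ⟨mem_rootedLaminars.2 ⟨hG'.pruneLeaf hxA hA, ?_⟩,
        mem_pruneLeaf.2 ⟨hv.notMem, hv2, Or.inl hvG⟩⟩
      have := card_hangLeaf (F := pruneLeaf x (insert v G))
        (fun S hS => (mem_pruneLeaf.1 hS).1) hv.notMem
      rw [heq, Finset.card_insert_of_notMem hPG.1, hk] at this
      exact (Nat.succ.inj this).symm
    · dsimp only
      rw [heq, Finset.erase_insert hPG.1]

theorem card_rootedLaminars_insert (hxA : x ∉ A) (hA : 2 ≤ A.card) (k : ℕ) :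
    (rootedLaminars (insert x A) (k + 1)).card =
      (k + 1) * (rootedLaminars A (k + 1)).card + (k + A.card) * (rootedLaminars A k).card := by
  classical
  let P : Finset (Finset α) → Prop := fun F => ∃ v, IsStem x F v ∧ (v ∈ F ∨ v.card = 1)
  have hP : ∀ F v, IsStem x F v → (P F ↔ v ∈ F ∨ v.card = 1) := fun F v hv =>
    ⟨fun ⟨w, hw, h⟩ => hv.eq hw ▸ h, fun h => ⟨v, hv, h⟩⟩
  rw [← Finset.card_filter_add_card_filter_not P, card_rootedLaminars_edge hxA hA k P hP,
    card_rootedLaminars_vertex hxA hA (k + 1) P hP, add_comm]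

end

/-- Faces of the Whitehouse complex are rooted laminar families with the root removed. -/
theorem isWhFace_iff_s3 {n : ℕ} (hn : 3 ≤ n) {F : Finset (Finset ℕ)} :
    IsWhFace n F ↔
      Finset.Icc 2 n ∉ F ∧ IsRootedLaminar (Finset.Icc 2 n) (insert (Finset.Icc 2 n) F) := by
  have hcard : (Finset.Icc 2 n).card = n - 1 := by simp
  constructor
  · rintro ⟨h1, h2⟩
    refine ⟨fun h => ?_, ?_, ?_, fun S hS T hT => ?_, Finset.mem_insert_self _ _⟩
    · have := (h1 _ h).2.2
      omega
    · rw [Finset.forall_mem_insert]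
      exact ⟨subset_rfl, fun S hS => (h1 S hS).1⟩
    · rw [Finset.forall_mem_insert]
      exact ⟨by omega, fun S hS => (h1 S hS).2.1⟩
    · rcases Finset.mem_insert.1 hS with rfl | hSF
      · rcases Finset.mem_insert.1 hT with rfl | hTF
        · exact Or.inl subset_rfl
        · exact Or.inr (Or.inl (h1 T hTF).1)
      · rcases Finset.mem_insert.1 hT with rfl | hTF
        · exact Or.inl (h1 S hSF).1
        · exact h2 S hSF T hTF
  · rintro ⟨hA, h⟩
    refine ⟨fun S hS => ?_, fun S hS T hT => h.laminar _ (Finset.mem_insert_of_mem hS) _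
      (Finset.mem_insert_of_mem hT)⟩
    have hsub := h.subset S (Finset.mem_insert_of_mem hS)
    refine ⟨hsub, h.two_le S (Finset.mem_insert_of_mem hS), ?_⟩
    have hne : S ≠ Finset.Icc 2 n := fun h => hA (h ▸ hS)
    have := Finset.card_lt_card (Finset.ssubset_iff_subset_ne.2 ⟨hsub, hne⟩)
    omega

theorem whf_eq_card_rootedLaminars {n : ℕ} (hn : 3 ≤ n) (k : ℕ) :
    whf n ((k : ℤ) - 2) = (rootedLaminars (Finset.Icc 2 n) k).card := by
  have hset : {F : Finset (Finset ℕ) | IsWhFace n F ∧ (F.card : ℤ) = (k : ℤ) - 2 + 1} =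
      ((rootedLaminars (Finset.Icc 2 n) k).image fun F => F.erase (Finset.Icc 2 n) :
        Finset (Finset (Finset ℕ))) := by
    ext F
    simp only [Set.mem_ofPred_eq, Finset.coe_image, Set.mem_image, Finset.mem_coe,
      mem_rootedLaminars]
    constructor
    · rintro ⟨hF, hk⟩
      obtain ⟨hA, h⟩ := (isWhFace_iff_s3 hn).1 hF
      refine ⟨_, ⟨h, ?_⟩, Finset.erase_insert hA⟩
      rw [Finset.card_insert_of_notMem hA]
      omega
    · rintro ⟨G, ⟨hG, hk⟩, rfl⟩
      refine ⟨(isWhFace_iff_s3 hn).2 ⟨Finset.notMem_erase _ _, ?_⟩, ?_⟩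
      · rwa [Finset.insert_erase hG.root_mem]
      · have := Finset.card_erase_add_one hG.root_mem
        omega
  rw [whf, hset, Set.ncard_coe_finset, Finset.card_image_of_injOn]
  intro F hF G hG h
  rw [Finset.mem_coe, mem_rootedLaminars] at hF hG
  dsimp only at h
  rw [← Finset.insert_erase hF.1.root_mem, h, Finset.insert_erase hG.1.root_mem]

theorem whf_neg_one (n : ℕ) : whf n (-1) = 1 := by
  rw [whf, Set.ncard_eq_one]
  refine ⟨∅, Set.ext fun F => ?_⟩
  simp only [Set.mem_ofPred_eq, Set.mem_singleton_iff]
  constructor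
  · rintro ⟨-, h⟩
    exact Finset.card_eq_zero.1 (by omega)
  · rintro rfl
    simp [IsWhFace]

theorem stmt3 (n : ℕ) (hn : 4 ≤ n) :
    whf n (-1) = 1 ∧
    ∀ i : ℤ, -1 ≤ i → i ≤ (n : ℤ) - 4 →
      (whf n i : ℤ) = (i + 2) * whf (n - 1) i + ((n : ℤ) + i - 1) * whf (n - 1) (i - 1) := by
  refine ⟨whf_neg_one n, fun i hi _ => ?_⟩
  obtain ⟨k, hk⟩ := Int.eq_ofNat_of_zero_le (show 0 ≤ i + 1 by omega)
  obtain ⟨m, rfl⟩ : ∃ m, n = m + 1 := ⟨n - 1, by omega⟩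
  obtain rfl : i = ((k + 1 : ℕ) : ℤ) - 2 := by
    push_cast
    omega
  have hpred : ((k + 1 : ℕ) : ℤ) - 2 - 1 = (k : ℤ) - 2 := by
    push_cast
    ring
  have hins : Finset.Icc 2 (m + 1) = insert (m + 1) (Finset.Icc 2 m) := by
    ext a
    simp only [Finset.mem_Icc, Finset.mem_insert]
    omega
  have hcard : (Finset.Icc 2 m).card + 1 = m := by
    rw [Nat.card_Icc]
    omega
  rw [Nat.add_sub_cancel, hpred, whf_eq_card_rootedLaminars (by omega),
    whf_eq_card_rootedLaminars (by omega), whf_eq_card_rootedLaminars (by omega), hins,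
    card_rootedLaminars_insert (by simp) (by omega)]
  have hm : (m : ℤ) = (Finset.Icc 2 m).card + 1 := by exact_mod_cast hcard.symm
  push_cast [hm]
  ring
end

section
/- For every integer n ≥ 3, the number of facets of the Whitehouse complex Δ_n equals the double factorial (2n−5)!! = (2n−5)·(2n−7)···3·1. -/
open Finset

namespace Laminar

variable {α : Type*} [DecidableEq α]

/-- Two sets are compatible if they are nested or disjoint. -/
def Compat (S T : Finset α) : Prop := S ⊆ T ∨ T ⊆ S ∨ S ∩ T = ∅

lemma Compat.symm {S T : Finset α} (h : Compat S T) : Compat T S := by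
  rcases h with h | h | h
  · exact Or.inr (Or.inl h)
  · exact Or.inl h
  · exact Or.inr (Or.inr (by rwa [inter_comm]))

lemma compat_of_disjoint {S T A B : Finset α} (hAB : Disjoint A B) (hS : S ⊆ A) (hT : T ⊆ B) :
    Compat S T :=
  Or.inr (Or.inr (disjoint_iff_inter_eq_empty.1 (hAB.mono hS hT)))

lemma compat_singleton (S : Finset α) (x : α) : Compat S {x} := by
  by_cases hx : x ∈ S
  · exact Or.inr (Or.inl (by simpa using hx))
  · exact Or.inr (Or.inr (by simp [hx]))

/-- `F` is a maximal laminar family of nonempty subsets of `X`: its members are exactly the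
nonempty subsets of `X` compatible with all members of `F`. -/
def IsMaxLaminar (X : Finset α) (F : Finset (Finset α)) : Prop :=
  ∀ T, T ∈ F ↔ T ⊆ X ∧ T.Nonempty ∧ ∀ S ∈ F, Compat S T

namespace IsMaxLaminar

variable {X A B : Finset α} {F F₁ F₂ : Finset (Finset α)}

lemma subset (h : IsMaxLaminar X F) {T : Finset α} (hT : T ∈ F) : T ⊆ X := ((h T).1 hT).1

lemma nonempty (h : IsMaxLaminar X F) {T : Finset α} (hT : T ∈ F) : T.Nonempty :=
  ((h T).1 hT).2.1

lemma compat (h : IsMaxLaminar X F) {S T : Finset α} (hS : S ∈ F) (hT : T ∈ F) : Compat S T :=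
  ((h T).1 hT).2.2 S hS

lemma top_mem (h : IsMaxLaminar X F) (hX : X.Nonempty) : X ∈ F :=
  (h X).2 ⟨Subset.rfl, hX, fun _ hS => Or.inl (h.subset hS)⟩

lemma singleton_mem (h : IsMaxLaminar X F) {x : α} (hx : x ∈ X) : {x} ∈ F :=
  (h _).2 ⟨by simpa using hx, by simp, fun S _ => compat_singleton S x⟩

/-- Restriction of a maximal laminar family to one block of a partition of the ground set into
two members. -/
lemma filter_subset (h : IsMaxLaminar X F) (hA : A ⊆ X)
    (hF : ∀ S ∈ F, S = X ∨ S ⊆ A ∨ Disjoint A S) : IsMaxLaminar A {S ∈ F | S ⊆ A} := by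
  intro T
  rw [mem_filter]
  constructor
  · rintro ⟨hT, hTA⟩
    exact ⟨hTA, h.nonempty hT, fun S hS => h.compat (mem_filter.1 hS).1 hT⟩
  · rintro ⟨hTA, hT, hc⟩
    refine ⟨(h T).2 ⟨hTA.trans hA, hT, fun S hS => ?_⟩, hTA⟩
    rcases hF S hS with rfl | hSA | hd
    · exact Or.inr (Or.inl (hTA.trans hA))
    · exact hc S (mem_filter.2 ⟨hS, hSA⟩)
    · exact compat_of_disjoint hd.symm Subset.rfl hTA

/-- Joining maximal laminar families on two disjoint nonempty sets. -/
lemma insert_union (h₁ : IsMaxLaminar A F₁) (h₂ : IsMaxLaminar B F₂) (hA : A.Nonempty)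
    (hB : B.Nonempty) (hAB : Disjoint A B) :
    IsMaxLaminar (A ∪ B) (insert (A ∪ B) (F₁ ∪ F₂)) := by
  intro T
  constructor
  · intro hT
    have key : ∀ S ∈ insert (A ∪ B) (F₁ ∪ F₂), S ⊆ A ∪ B ∧ S.Nonempty := by
      intro S hS
      rcases mem_insert.1 hS with rfl | hS
      · exact ⟨Subset.rfl, hA.mono subset_union_left⟩
      rcases mem_union.1 hS with hS | hS
      · exact ⟨(h₁.subset hS).trans subset_union_left, h₁.nonempty hS⟩
      · exact ⟨(h₂.subset hS).trans subset_union_right, h₂.nonempty hS⟩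
    refine ⟨(key T hT).1, (key T hT).2, fun S hS => ?_⟩
    have hS' := (key S hS).1
    have hT' := (key T hT).1
    rcases mem_insert.1 hS with rfl | hS
    · exact Or.inr (Or.inl hT')
    rcases mem_insert.1 hT with rfl | hT
    · exact Or.inl hS'
    rcases mem_union.1 hS with hS | hS <;> rcases mem_union.1 hT with hT | hT
    · exact h₁.compat hS hT
    · exact compat_of_disjoint hAB (h₁.subset hS) (h₂.subset hT)
    · exact compat_of_disjoint hAB.symm (h₂.subset hS) (h₁.subset hT)
    · exact h₂.compat hS hT
  · rintro ⟨hTX, hT, hc⟩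
    have inA : T ⊆ A → T ∈ insert (A ∪ B) (F₁ ∪ F₂) := fun hTA =>
      mem_insert_of_mem (mem_union_left _ ((h₁ T).2
        ⟨hTA, hT, fun S hS => hc S (mem_insert_of_mem (mem_union_left _ hS))⟩))
    have inB : T ⊆ B → T ∈ insert (A ∪ B) (F₁ ∪ F₂) := fun hTB =>
      mem_insert_of_mem (mem_union_right _ ((h₂ T).2
        ⟨hTB, hT, fun S hS => hc S (mem_insert_of_mem (mem_union_right _ hS))⟩))
    have cA := hc A (mem_insert_of_mem (mem_union_left _ (h₁.top_mem hA)))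
    have cB := hc B (mem_insert_of_mem (mem_union_right _ (h₂.top_mem hB)))
    rcases cA with hAT | hTA | hd
    · rcases cB with hBT | hTB | hd
      · exact mem_insert.2 (Or.inl (hTX.antisymm (union_subset hAT hBT)))
      · exact inB hTB
      · refine inA fun x hx => (mem_union.1 (hTX hx)).resolve_right fun hxB => ?_
        exact notMem_empty x (hd ▸ mem_inter.2 ⟨hxB, hx⟩)
    · exact inA hTA
    · refine inB fun x hx => (mem_union.1 (hTX hx)).resolve_left fun hxA => ?_
      exact notMem_empty x (hd ▸ mem_inter.2 ⟨hxA, hx⟩)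

/-- The ground set of a maximal laminar family splits into two members, one of them containing a
prescribed point. -/
lemma exists_split (h : IsMaxLaminar X F) {x : α} (hx : x ∈ X) (hX : X ≠ {x}) :
    ∃ A ∈ F, x ∈ A ∧ A ≠ X ∧ ∀ S ∈ F, S = X ∨ S ⊆ A ∨ S ⊆ X \ A := by
  obtain ⟨A, hA, hmax⟩ := exists_max_image {S ∈ F | x ∈ S ∧ S ≠ X} card
    ⟨{x}, mem_filter.2 ⟨h.singleton_mem hx, by simp, hX.symm⟩⟩
  obtain ⟨hAF, hxA, hAX⟩ := mem_filter.1 hA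
  refine ⟨A, hAF, hxA, hAX, fun S hS => ?_⟩
  by_cases hSX : S = X
  · exact Or.inl hSX
  rcases h.compat hAF hS with hAS | hSA | hd
  · have := hmax S (mem_filter.2 ⟨hS, hAS hxA, hSX⟩)
    exact Or.inr (Or.inl (eq_of_subset_of_card_le hAS this).symm.subset)
  · exact Or.inr (Or.inl hSA)
  · exact Or.inr (Or.inr (subset_sdiff.2 ⟨h.subset hS, (disjoint_iff_inter_eq_empty.2 hd).symm⟩))

end IsMaxLaminar

open Classical in
/-- The finite set of maximal laminar families on `X`. -/
noncomputable def maxLaminar (X : Finset α) : Finset (Finset (Finset α)) :=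
  {F ∈ X.powerset.powerset | IsMaxLaminar X F}

lemma mem_maxLaminar {X : Finset α} {F : Finset (Finset α)} :
    F ∈ maxLaminar X ↔ IsMaxLaminar X F := by
  simp only [maxLaminar, mem_filter, and_iff_right_iff_imp]
  exact fun h => mem_powerset.2 fun S hS => mem_powerset.2 (h.subset hS)

lemma filter_subset_insert_union {A B : Finset α} {F₁ F₂ : Finset (Finset α)}
    (h₁ : IsMaxLaminar A F₁) (h₂ : IsMaxLaminar B F₂) (hB : B.Nonempty) (hAB : Disjoint A B) :
    {S ∈ insert (A ∪ B) (F₁ ∪ F₂) | S ⊆ A} = F₁ := by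
  have aux : ∀ S : Finset α, S ⊆ A → S ⊆ B → ¬ S.Nonempty := fun S hA hB' ⟨y, hy⟩ =>
    disjoint_left.1 hAB (hA hy) (hB' hy)
  ext S
  simp only [mem_filter, mem_insert, mem_union]
  constructor
  · rintro ⟨rfl | hS | hS, hSA⟩
    · exact absurd hB (aux B (subset_union_right.trans hSA) Subset.rfl)
    · exact hS
    · exact absurd (h₂.nonempty hS) (aux S hSA (h₂.subset hS))
  · exact fun hS => ⟨Or.inr (Or.inl hS), h₁.subset hS⟩

lemma card_maxLaminar_eq_sum {X : Finset α} {x : α} (hx : x ∈ X) (hX : X ≠ {x}) :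
    #(maxLaminar X) = ∑ B ∈ (X.erase x).powerset.erase ∅,
      #(maxLaminar (X \ B)) * #(maxLaminar B) := by
  simp_rw [← card_product]
  rw [← card_sigma]
  symm
  have hsplit : ∀ B ∈ (X.erase x).powerset.erase ∅,
      B.Nonempty ∧ x ∈ X \ B ∧ X \ B ∪ B = X ∧ Disjoint (X \ B) B := by
    intro B hB
    obtain ⟨hne, hB⟩ := mem_erase.1 hB
    have hB := mem_powerset.1 hB
    have hBX := hB.trans (erase_subset _ _)
    exact ⟨nonempty_iff_ne_empty.2 hne, mem_sdiff.2 ⟨hx, fun h => notMem_erase x X (hB h)⟩,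
      sdiff_union_of_subset hBX, sdiff_disjoint⟩
  refine card_bij (fun p _ => insert X (p.2.1 ∪ p.2.2)) ?_ ?_ ?_
  · rintro ⟨B, F₁, F₂⟩ hp
    simp only [mem_sigma, mem_product, mem_maxLaminar] at hp
    obtain ⟨hB, h₁, h₂⟩ := hp
    obtain ⟨hne, hxA, hU, hd⟩ := hsplit B hB
    have := h₁.insert_union h₂ ⟨x, hxA⟩ hne hd
    rw [hU] at this
    exact mem_maxLaminar.2 this
  · have key : ∀ B ∈ (X.erase x).powerset.erase ∅, ∀ F₁ F₂ B' F₁' F₂',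
        B' ∈ (X.erase x).powerset.erase ∅ →
        IsMaxLaminar (X \ B) F₁ → IsMaxLaminar (X \ B') F₁' →
        IsMaxLaminar B' F₂' → insert X (F₁ ∪ F₂) = insert X (F₁' ∪ F₂') → B' ⊆ B := by
      intro B hB F₁ F₂ B' F₁' F₂' hB' h₁ h₁' h₂' he
      obtain ⟨hne, hxA, hU, hd⟩ := hsplit B hB
      obtain ⟨hne', hxA', hU', hd'⟩ := hsplit B' hB'
      have hm : X \ B ∈ insert X (F₁' ∪ F₂') :=
        he ▸ mem_insert_of_mem (mem_union_left _ (h₁.top_mem ⟨x, hxA⟩))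
      intro y hy
      have hyX : y ∈ X := hU' ▸ mem_union_right _ hy
      rcases mem_insert.1 hm with hm | hm
      · obtain ⟨z, hz⟩ := hne
        have hzX : z ∈ X \ B := by
          rw [hm, ← hU]
          exact mem_union_right _ hz
        exact absurd hz (mem_sdiff.1 hzX).2
      rcases mem_union.1 hm with hm | hm
      · by_contra hyB
        exact (mem_sdiff.1 (h₁'.subset hm (mem_sdiff.2 ⟨hyX, hyB⟩))).2 hy
      · exact absurd (h₂'.subset hm hxA) (mem_sdiff.1 hxA').2
    rintro ⟨B, F₁, F₂⟩ hp ⟨B', F₁', F₂'⟩ hp' he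
    simp only [mem_sigma, mem_product, mem_maxLaminar] at hp hp' he
    obtain ⟨hB, h₁, h₂⟩ := hp
    obtain ⟨hB', h₁', h₂'⟩ := hp'
    obtain rfl : B = B' := Subset.antisymm
      (key B' hB' F₁' F₂' B F₁ F₂ hB h₁' h₁ h₂ he.symm)
      (key B hB F₁ F₂ B' F₁' F₂' hB' h₁ h₁' h₂' he)
    obtain ⟨hne, hxA, hU, hd⟩ := hsplit B hB
    have e₁ := filter_subset_insert_union h₁ h₂ hne hd
    have e₁' := filter_subset_insert_union h₁' h₂' hne hd
    have e₂ := filter_subset_insert_union h₂ h₁ ⟨x, hxA⟩ hd.symm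
    have e₂' := filter_subset_insert_union h₂' h₁' ⟨x, hxA⟩ hd.symm
    rw [hU] at e₁ e₁'
    rw [union_comm, hU, union_comm] at e₂ e₂'
    rw [he] at e₁ e₂
    rw [← e₁, ← e₂, e₁', e₂']
  · intro F hF
    have h := mem_maxLaminar.1 hF
    obtain ⟨A, hAF, hxA, hAX, hS⟩ := h.exists_split hx hX
    have hAsub := h.subset hAF
    have hAA : X \ (X \ A) = A := Finset.sdiff_sdiff_eq_self hAsub
    refine ⟨⟨X \ A, {S ∈ F | S ⊆ A}, {S ∈ F | S ⊆ X \ A}⟩, ?_, ?_⟩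
    · simp only [mem_sigma, mem_product, mem_maxLaminar, mem_erase, mem_powerset, hAA]
      refine ⟨⟨fun he => hAX (hAsub.antisymm (sdiff_eq_empty_iff_subset.1 he)), ?_⟩,
        h.filter_subset hAsub fun S hSF => ?_, h.filter_subset sdiff_subset fun S hSF => ?_⟩
      · intro y hy
        obtain ⟨hyX, hyA⟩ := mem_sdiff.1 hy
        exact mem_erase.2 ⟨fun e => hyA (e ▸ hxA), hyX⟩
      · exact (hS S hSF).imp_right (Or.imp_right fun hd => disjoint_sdiff.mono_right hd)
      · exact (hS S hSF).imp_right fun ho => ho.symm.imp_right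
          fun hd => sdiff_disjoint.mono_right hd
    · ext S
      simp only [mem_insert, mem_union, mem_filter]
      constructor
      · rintro (rfl | hS | hS)
        · exact h.top_mem ⟨x, hx⟩
        · exact hS.1
        · exact hS.1
      · intro hSF
        rcases hS S hSF with rfl | hSA | hSB
        · exact Or.inl rfl
        · exact Or.inr (Or.inl ⟨hSF, hSA⟩)
        · exact Or.inr (Or.inr ⟨hSF, hSB⟩)

lemma card_maxLaminar_singleton (x : α) : #(maxLaminar {x}) = 1 := by
  rw [card_eq_one]
  refine ⟨{{x}}, ?_⟩
  ext F
  rw [mem_maxLaminar, mem_singleton]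
  constructor
  · intro h
    ext T
    rw [mem_singleton]
    constructor
    · intro hT
      exact ((h.nonempty hT).subset_singleton_iff).1 (h.subset hT)
    · rintro rfl
      exact h.singleton_mem (mem_singleton_self x)
  · rintro rfl T
    rw [mem_singleton]
    constructor
    · rintro rfl
      exact ⟨Subset.rfl, by simp, fun S _ => compat_singleton S x⟩
    · rintro ⟨hT, hne, -⟩
      exact hne.subset_singleton_iff.1 hT

end Laminar

open Nat in
lemma two_pow_mul_doubleFactorial_eq (m : ℕ) :
    2 ^ m * (2 * m - 1)‼ = (m + 1)! * catalan m := by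
  have h : ∀ m : ℕ, 2 ^ m * (2 * m - 1)‼ = m ! * centralBinom m := by
    intro m
    induction m with
    | zero => simp
    | succ k ih =>
      have e : (2 * (k + 1) - 1)‼ = (2 * k + 1) * (2 * k - 1)‼ := by
        rcases k with _ | k
        · simp
        · exact doubleFactorial_add_two (2 * k + 1)
      have := succ_mul_centralBinom_succ k
      rw [e, factorial_succ, pow_succ]
      calc _ = 2 * (2 * k + 1) * (2 ^ k * (2 * k - 1)‼) := by ring
        _ = k ! * (2 * (2 * k + 1) * centralBinom k) := by rw [ih]; ring
        _ = _ := by rw [← this]; ring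
  rw [h, factorial_succ, ← succ_mul_catalan_eq_centralBinom]
  ring

open Nat in
lemma sum_choose_mul_doubleFactorial (m : ℕ) :
    ∑ p ∈ antidiagonal m, (m + 1).choose (p.2 + 1) * ((2 * p.1 - 1)‼ * (2 * p.2 - 1)‼) =
      (2 * (m + 1) - 1)‼ := by
  have h₁ : 2 ^ m * ∑ p ∈ antidiagonal m,
      (m + 1).choose (p.2 + 1) * ((2 * p.1 - 1)‼ * (2 * p.2 - 1)‼) =
      (m + 1)! * ∑ p ∈ antidiagonal m, (p.1 + 1) * (catalan p.1 * catalan p.2) := by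
    rw [mul_sum, mul_sum]
    refine sum_congr rfl fun p hp => ?_
    obtain ⟨i, j⟩ := p
    obtain rfl := mem_antidiagonal.1 hp
    dsimp only
    have hc : (i + j + 1).choose (j + 1) * (j + 1)! * i ! = (i + j + 1)! := by
      have := choose_mul_factorial_mul_factorial (show j + 1 ≤ i + j + 1 by omega)
      rwa [show i + j + 1 - (j + 1) = i by omega] at this
    calc _ = (i + j + 1).choose (j + 1) * ((2 ^ i * (2 * i - 1)‼) * (2 ^ j * (2 * j - 1)‼)) := by
          rw [pow_add]; ring
      _ = ((i + j + 1).choose (j + 1) * (j + 1)! * i !) * ((i + 1) * (catalan i * catalan j)) := by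
          rw [two_pow_mul_doubleFactorial_eq, two_pow_mul_doubleFactorial_eq, factorial_succ i]
          ring
      _ = _ := by rw [hc]
  have h₂ : 2 * ∑ p ∈ antidiagonal m, (p.1 + 1) * (catalan p.1 * catalan p.2) =
      (m + 2) * catalan (m + 1) := by
    rw [catalan_succ', two_mul]
    nth_rw 1 [← sum_antidiagonal_swap]
    rw [← sum_add_distrib, mul_sum]
    refine sum_congr rfl fun p hp => ?_
    rw [← mem_antidiagonal.1 hp]
    simp only [Prod.fst_swap, Prod.snd_swap]
    ring
  apply Nat.eq_of_mul_eq_mul_left (show 0 < 2 ^ (m + 1) by positivity)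
  rw [two_pow_mul_doubleFactorial_eq, pow_succ, mul_right_comm, h₁, factorial_succ (m + 1)]
  calc _ = (m + 1)! * (2 * ∑ p ∈ antidiagonal m, (p.1 + 1) * (catalan p.1 * catalan p.2)) := by
        ring
    _ = _ := by rw [h₂]; ring

namespace Laminar

variable {α : Type*} [DecidableEq α]

open Nat in
/-- There are `(2m - 1)‼` maximal laminar families on a set with `m + 1` elements. -/
theorem card_maxLaminar (m : ℕ) (X : Finset α) (hX : #X = m + 1) :
    #(maxLaminar X) = (2 * m - 1)‼ := by
  induction m using Nat.strong_induction_on generalizing X with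
  | _ m ih =>
  obtain ⟨x, hx⟩ : X.Nonempty := card_pos.1 (by omega)
  rcases m with _ | m
  · obtain ⟨y, rfl⟩ := card_eq_one.1 hX
    simpa using card_maxLaminar_singleton y
  have hXx : X ≠ {x} := by
    rintro rfl
    simp at hX
  have hE : #(X.erase x) = m + 1 := by rw [card_erase_of_mem hx, hX]; rfl
  let f : ℕ → ℕ := fun k => if k = 0 then 0 else
    (2 * (m + 1 - k) - 1)‼ * (2 * (k - 1) - 1)‼
  have hf : ∀ B ∈ (X.erase x).powerset.erase ∅,
      #(maxLaminar (X \ B)) * #(maxLaminar B) = f #B := by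
    intro B hB
    obtain ⟨hne, hB⟩ := mem_erase.1 hB
    have hB := mem_powerset.1 hB
    have hpos : 0 < #B := card_pos.2 (nonempty_iff_ne_empty.2 hne)
    have hle := hE ▸ card_le_card hB
    have hsd := card_sdiff_of_subset (hB.trans (erase_subset _ _))
    rw [ih (m + 1 - #B) (by omega) (X \ B) (by omega), ih (#B - 1) (by omega) B (by omega)]
    simp only [f, if_neg hpos.ne']
  rw [card_maxLaminar_eq_sum hx hXx, sum_congr rfl hf, sum_erase _ (by simp [f]),
    sum_powerset_apply_card, hE, sum_range_succ', ← sum_choose_mul_doubleFactorial,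
    ← sum_antidiagonal_swap, Nat.sum_antidiagonal_eq_sum_range_succ_mk]
  simp [f]

end Laminar

open Laminar

lemma isWhFace_facet_iff (n : ℕ) (F : Finset (Finset ℕ)) :
    (IsWhFace n F ∧ ∀ G : Finset (Finset ℕ), IsWhFace n G → F ⊆ G → F = G) ↔
      ∀ T, T ∈ F ↔ (T ⊆ Icc 2 n ∧ 2 ≤ #T ∧ #T ≤ n - 2) ∧ ∀ S ∈ F, Compat S T := by
  constructor
  · rintro ⟨⟨hv, hc⟩, hmax⟩ T
    refine ⟨fun hT => ⟨hv T hT, fun S hS => hc S hS T hT⟩, fun ⟨hT, hcT⟩ => ?_⟩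
    rw [hmax (insert T F) ⟨?_, ?_⟩ (subset_insert _ _)]
    · exact mem_insert_self _ _
    · intro S hS
      rcases mem_insert.1 hS with rfl | hS
      · exact hT
      · exact hv S hS
    · intro S hS U hU
      rcases mem_insert.1 hS with rfl | hSF <;> rcases mem_insert.1 hU with rfl | hUF
      · exact Or.inl Subset.rfl
      · exact (hcT U hUF).symm
      · exact hcT S hSF
      · exact hc S hSF U hUF
  · intro h
    refine ⟨⟨fun S hS => ((h S).1 hS).1, fun S hS T hT => ((h T).1 hT).2 S hS⟩, ?_⟩
    intro G hG hFG
    exact hFG.antisymm fun T hT => (h T).2 ⟨hG.1 T hT, fun S hS => hG.2 S (hFG hS) T hT⟩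

/-- The Whitehouse complex `Δ_n` has exactly `(2n-5)!!` facets. -/
theorem stmt5 (n : ℕ) (hn : 3 ≤ n) :
    Set.ncard {F : Finset (Finset ℕ) | IsWhFace n F ∧
      ∀ G : Finset (Finset ℕ), IsWhFace n G → F ⊆ G → F = G} =
      Nat.doubleFactorial (2 * n - 5) := by
  have hX : #(Icc 2 n) = (n - 2) + 1 := by rw [Nat.card_Icc]; omega
  rw [show 2 * n - 5 = 2 * (n - 2) - 1 by omega, ← card_maxLaminar (n - 2) (Icc 2 n) hX,
    ← Set.ncard_coe_finset]
  simp_rw [isWhFace_facet_iff]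
  have hne : (Icc 2 n).Nonempty := card_pos.1 (by omega)
  have hcases : ∀ T ⊆ Icc 2 n, T.Nonempty →
      T = Icc 2 n ∨ (∃ x ∈ Icc 2 n, T = {x}) ∨ (2 ≤ #T ∧ #T ≤ n - 2) := by
    intro T hT hTne
    by_cases hTX : T = Icc 2 n
    · exact Or.inl hTX
    have hlt := card_lt_card (hT.ssubset_of_ne hTX)
    have hpos := card_pos.2 hTne
    by_cases h1 : #T = 1
    · obtain ⟨x, rfl⟩ := card_eq_one.1 h1
      exact Or.inr (Or.inl ⟨x, by simpa using hT, rfl⟩)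
    · exact Or.inr (Or.inr (by omega))
  symm
  refine Set.ncard_congr (fun F _ => {S ∈ F | 2 ≤ #S ∧ #S ≤ n - 2}) ?_ ?_ ?_
  · intro F hF T
    have h := mem_maxLaminar.1 hF
    rw [mem_filter]
    constructor
    · rintro ⟨hT, hcard⟩
      exact ⟨⟨h.subset hT, hcard⟩, fun S hS => h.compat (mem_filter.1 hS).1 hT⟩
    · rintro ⟨⟨hT, hcard⟩, hc⟩
      refine ⟨(h T).2 ⟨hT, card_pos.1 (by omega), fun S hS => ?_⟩, hcard⟩
      rcases hcases S (h.subset hS) (h.nonempty hS) with rfl | ⟨x, -, rfl⟩ | hS'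
      · exact Or.inr (Or.inl hT)
      · exact (compat_singleton T x).symm
      · exact hc S (mem_filter.2 ⟨hS, hS'⟩)
  · have key : ∀ F G, IsMaxLaminar (Icc 2 n) F → IsMaxLaminar (Icc 2 n) G →
        ({S ∈ F | 2 ≤ #S ∧ #S ≤ n - 2} : Finset (Finset ℕ)) = {S ∈ G | 2 ≤ #S ∧ #S ≤ n - 2} →
        F ⊆ G := by
      intro F G hF hG he T hT
      rcases hcases T (hF.subset hT) (hF.nonempty hT) with rfl | ⟨x, hx, rfl⟩ | hT'
      · exact hG.top_mem hne
      · exact hG.singleton_mem hx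
      · exact (mem_filter.1 (he ▸ mem_filter.2 ⟨hT, hT'⟩)).1
    intro F G hF hG he
    have hF := mem_maxLaminar.1 hF
    have hG := mem_maxLaminar.1 hG
    exact (key F G hF hG he).antisymm (key G F hG hF he.symm)
  · intro F hF
    refine ⟨insert (Icc 2 n) ((Icc 2 n).image singleton ∪ F), ?_, ?_⟩
    · refine mem_maxLaminar.2 fun T => ?_
      have hmem : ∀ S, S ∈ insert (Icc 2 n) ((Icc 2 n).image singleton ∪ F) ↔
          S = Icc 2 n ∨ (∃ x ∈ Icc 2 n, S = {x}) ∨ S ∈ F := by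
        intro S
        simp only [mem_insert, mem_union, mem_image, eq_comm]
      constructor
      · intro hT
        have hsub : ∀ S ∈ insert (Icc 2 n) ((Icc 2 n).image singleton ∪ F),
            S ⊆ Icc 2 n ∧ S.Nonempty := by
          intro S hS
          rcases (hmem S).1 hS with rfl | ⟨x, hx, rfl⟩ | hS
          · exact ⟨Subset.rfl, hne⟩
          · exact ⟨by simpa using hx, by simp⟩
          · have := ((hF S).1 hS).1
            exact ⟨this.1, card_pos.1 (by omega)⟩
        refine ⟨(hsub T hT).1, (hsub T hT).2, fun S hS => ?_⟩
        have hSX := (hsub S hS).1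
        have hTX := (hsub T hT).1
        rcases (hmem S).1 hS with rfl | ⟨x, hx, rfl⟩ | hS
        · exact Or.inr (Or.inl hTX)
        · exact (compat_singleton T x).symm
        rcases (hmem T).1 hT with rfl | ⟨x, hx, rfl⟩ | hT
        · exact Or.inl hSX
        · exact compat_singleton S x
        · exact ((hF T).1 hT).2 S hS
      · rintro ⟨hT, hTne, hc⟩
        rw [hmem]
        rcases hcases T hT hTne with h | h | h
        · exact Or.inl h
        · exact Or.inr (Or.inl h)
        · exact Or.inr (Or.inr ((hF T).2
            ⟨⟨hT, h⟩, fun S hS => hc S ((hmem S).2 (Or.inr (Or.inr hS)))⟩))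
    · ext T
      simp only [mem_filter, mem_insert, mem_union, mem_image]
      constructor
      · rintro ⟨rfl | ⟨x, -, rfl⟩ | hT, h2, hn2⟩
        · omega
        · simp at h2
        · exact hT
      · exact fun hT => ⟨Or.inr (Or.inr hT), ((hF T).1 hT).1.2⟩
end

section
/- For n ≥ 4, let f_{n,i} be the number of i-dimensional faces of the Whitehouse complex Δ_n and define the h-vector entries by h_{n,k} = Σ_{i=0}^{k} (−1)^{k−i} · C(n−3−i, k−i) · f_{n,i−1} for 0 ≤ k ≤ n−3 (with h_{m,k} = 0 for k outside the range 0 ≤ k ≤ m−3). Then h_{n,k} = (k+1)·h_{n−1,k} + (2n−k−5)·h_{n−1,k−1} for all 0 ≤ k ≤ n−3. -/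
/-- The number of faces of `Δ_n` with exactly `j` elements (so `f_{n,j-1}`). -/
noncomputable def whfc (n j : ℕ) : ℕ :=
  Set.ncard {F : Finset (Finset ℕ) | IsWhFace n F ∧ F.card = j}

/-- The `h`-vector entry `h_{n,k} = ∑_{i=0}^{k} (-1)^{k-i} C(n-3-i, k-i) f_{n,i-1}`
for `0 ≤ k ≤ n-3`, and `h_{n,k} = 0` for `k` outside this range. -/
noncomputable def whh (n : ℕ) (k : ℤ) : ℤ :=
  if 0 ≤ k ∧ k ≤ (n : ℤ) - 3 then
    ∑ i ∈ Finset.range (k.toNat + 1),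
      (-1 : ℤ) ^ (k.toNat - i) * (Nat.choose (n - 3 - i) (k.toNat - i)) * whfc n i
  else 0

section LeafInsertion

variable {α : Type*}

/-- A phylogenetic tree with leaf set `X`, encoded as the laminar family of the leaf sets below its
nodes, with all leaves and the root included. -/
def IsTreeFamily (X : Finset α) (H : Finset (Finset α)) : Prop :=
  (∀ S ∈ H, S ⊆ X ∧ S.Nonempty) ∧ X ∈ H ∧ (∀ a ∈ X, {a} ∈ H) ∧
  ∀ S ∈ H, ∀ T ∈ H, S ⊆ T ∨ T ⊆ S ∨ Disjoint S T

open Classical in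
/-- The tree families on `X` with exactly `p` nodes. -/
noncomputable def treeFamilies (X : Finset α) (p : ℕ) : Finset (Finset (Finset α)) :=
  X.powerset.powerset.filter fun H => IsTreeFamily X H ∧ H.card = p

lemma mem_treeFamilies {X : Finset α} {p : ℕ} {H : Finset (Finset α)} :
    H ∈ treeFamilies X p ↔ IsTreeFamily X H ∧ H.card = p := by
  simp only [treeFamilies, Finset.mem_filter, Finset.mem_powerset, and_iff_right_iff_imp]
  intro h S hS
  exact Finset.mem_powerset.2 (h.1.1 S hS).1

lemma IsTreeFamily.notMem {X : Finset α} {H : Finset (Finset α)} {x : α} (hH : IsTreeFamily X H)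
    (hx : x ∉ X) {S : Finset α} (hS : S ∈ H) : x ∉ S :=
  fun h => hx ((hH.1 S hS).1 h)

variable [DecidableEq α]

/-- Add the leaf `x` to every set of the tree containing `v`. -/
def extendAbove (x : α) (v S : Finset α) : Finset α := if v ⊆ S then insert x S else S

/-- Attach a new leaf `x` as a child of the node `v`. -/
def attachAt (x : α) (H : Finset (Finset α)) (v : Finset α) : Finset (Finset α) :=
  insert {x} (H.image (extendAbove x v))

/-- Attach a new leaf `x` on the edge above the node `v`. -/
def attachAbove (x : α) (H : Finset (Finset α)) (v : Finset α) : Finset (Finset α) :=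
  insert v (attachAt x H v)

/-- Delete the leaf `x`. -/
def deleteLeaf (x : α) (G : Finset (Finset α)) : Finset (Finset α) :=
  (G.image fun S => S.erase x).erase ∅

/-- `v` is the set of the other leaves below the parent of the leaf `x`. -/
def IsSibling (x : α) (G : Finset (Finset α)) (v : Finset α) : Prop :=
  x ∉ v ∧ v.Nonempty ∧ insert x v ∈ G ∧ ∀ S ∈ G, x ∈ S → S ≠ {x} → v ⊆ S

lemma IsSibling.unique {x : α} {G : Finset (Finset α)} {v w : Finset α}
    (hv : IsSibling x G v) (hw : IsSibling x G w) : v = w := by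
  have key : ∀ {v w : Finset α}, IsSibling x G v → IsSibling x G w → v ⊆ w := by
    rintro v w ⟨hxv, -, -, hv⟩ ⟨hxw, ⟨a, ha⟩, hw, -⟩
    have hne : insert x w ≠ {x} := by
      intro h
      have : a ∈ ({x} : Finset α) := h ▸ Finset.mem_insert_of_mem ha
      exact hxw (Finset.mem_singleton.1 this ▸ ha)
    exact (Finset.subset_insert_iff_of_notMem hxv).1
      (hv _ hw (Finset.mem_insert_self _ _) hne)
  exact (key hv hw).antisymm (key hw hv)

lemma erase_extendAbove {x : α} {v S : Finset α} (hS : x ∉ S) :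
    (extendAbove x v S).erase x = S := by
  unfold extendAbove
  split_ifs <;> simp [hS]

lemma subset_extendAbove (x : α) (v S : Finset α) : S ⊆ extendAbove x v S := by
  unfold extendAbove
  split_ifs <;> simp

lemma extendAbove_injOn {x : α} {H : Finset (Finset α)} (v : Finset α) (hH : ∀ S ∈ H, x ∉ S) :
    Set.InjOn (extendAbove x v) H := by
  intro S hS T hT h
  rw [← erase_extendAbove (v := v) (hH S hS), h, erase_extendAbove (hH T hT)]

lemma mem_extendAbove_iff {x : α} {v S : Finset α} (hS : x ∉ S) :
    x ∈ extendAbove x v S ↔ v ⊆ S := by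
  unfold extendAbove
  split_ifs with h <;> simp [h, hS]

namespace IsTreeFamily

variable {X : Finset α} {H G : Finset (Finset α)} {x : α} {v : Finset α}

lemma singleton_notMem_image (hH : IsTreeFamily X H) (hx : x ∉ X) (v : Finset α) :
    {x} ∉ H.image (extendAbove x v) := by
  simp only [Finset.mem_image, not_exists, not_and]
  intro S hS h
  have := erase_extendAbove (v := v) (hH.notMem hx hS)
  rw [h] at this
  have hne := (hH.1 S hS).2
  simp [← this] at hne

lemma card_attachAt (hH : IsTreeFamily X H) (hx : x ∉ X) (v : Finset α) :
    (attachAt x H v).card = H.card + 1 := by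
  rw [attachAt, Finset.card_insert_of_notMem (hH.singleton_notMem_image hx v),
    Finset.card_image_of_injOn (extendAbove_injOn v fun S hS => hH.notMem hx hS)]

lemma notMem_attachAt (hH : IsTreeFamily X H) (hx : x ∉ X) (hv : v ∈ H) :
    v ∉ attachAt x H v := by
  have hxv := hH.notMem hx hv
  simp only [attachAt, Finset.mem_insert, Finset.mem_image, not_or, not_exists, not_and]
  refine ⟨fun h => hxv (by simp [h]), fun S hS h => ?_⟩
  have h1 : S = v := by
    rw [← erase_extendAbove (v := v) (hH.notMem hx hS), h, Finset.erase_eq_of_notMem hxv]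
  subst h1
  exact hxv (h ▸ (mem_extendAbove_iff hxv).2 subset_rfl)

lemma card_attachAbove (hH : IsTreeFamily X H) (hx : x ∉ X) (hv : v ∈ H) :
    (attachAbove x H v).card = H.card + 2 := by
  rw [attachAbove, Finset.card_insert_of_notMem (hH.notMem_attachAt hx hv), hH.card_attachAt hx]

lemma laminar_attachAt (hH : IsTreeFamily X H) (hx : x ∉ X) (hv : v ∈ H) :
    ∀ S ∈ attachAt x H v, ∀ T ∈ attachAt x H v, S ⊆ T ∨ T ⊆ S ∨ Disjoint S T := by
  have key : ∀ S ∈ H, ∀ T ∈ H, S ⊆ T → extendAbove x v S ⊆ extendAbove x v T := by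
    intro S _ T _ hST
    by_cases h : v ⊆ S
    · simpa [extendAbove, h, h.trans hST] using Finset.insert_subset_insert x hST
    · simpa [extendAbove, h] using hST.trans (subset_extendAbove x v T)
  simp only [attachAt, Finset.mem_insert, Finset.mem_image]
  rintro _ (rfl | ⟨S, hS, rfl⟩) _ (rfl | ⟨T, hT, rfl⟩)
  · simp
  · by_cases h : x ∈ extendAbove x v T <;> simp [h]
  · by_cases h : x ∈ extendAbove x v S <;> simp [h]
  · rcases hH.2.2.2 S hS T hT with h | h | h
    · exact Or.inl (key S hS T hT h)
    · exact Or.inr (Or.inl (key T hT S hS h))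
    · right; right
      have hxS := hH.notMem hx hS
      have hxT := hH.notMem hx hT
      have hvne := (hH.1 v hv).2
      unfold extendAbove
      split_ifs with h1 h2 h2
      · obtain ⟨a, ha⟩ := hvne
        exact absurd (h2 ha) (Finset.disjoint_left.1 h (h1 ha))
      · simp [h, hxT]
      · simp [h, hxS]
      · exact h

lemma laminar_attachAbove (hH : IsTreeFamily X H) (hx : x ∉ X) (hv : v ∈ H) :
    ∀ S ∈ attachAbove x H v, ∀ T ∈ attachAbove x H v, S ⊆ T ∨ T ⊆ S ∨ Disjoint S T := by
  have key : ∀ T ∈ attachAt x H v, v ⊆ T ∨ T ⊆ v ∨ Disjoint v T := by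
    simp only [attachAt, Finset.mem_insert, Finset.mem_image]
    rintro _ (rfl | ⟨T, hT, rfl⟩)
    · simp [hH.notMem hx hv]
    · by_cases h : v ⊆ T
      · exact Or.inl (h.trans (subset_extendAbove x v T))
      · simpa [extendAbove, h] using hH.2.2.2 v hv T hT
  intro S hS T hT
  rcases Finset.mem_insert.1 hS with rfl | hS <;> rcases Finset.mem_insert.1 hT with rfl | hT
  · simp
  · exact key T hT
  · rcases key S hS with h | h | h
    · exact Or.inr (Or.inl h)
    · exact Or.inl h
    · exact Or.inr (Or.inr h.symm)
  · exact hH.laminar_attachAt hx hv S hS T hT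

lemma subset_nonempty_attachAt (hH : IsTreeFamily X H) :
    ∀ S ∈ attachAt x H v, S ⊆ insert x X ∧ S.Nonempty := by
  simp only [attachAt, Finset.mem_insert, Finset.mem_image]
  rintro _ (rfl | ⟨S, hS, rfl⟩)
  · simp
  · refine ⟨?_, (hH.1 S hS).2.mono (subset_extendAbove x v S)⟩
    unfold extendAbove
    split_ifs
    · exact Finset.insert_subset_insert x (hH.1 S hS).1
    · exact (hH.1 S hS).1.trans (Finset.subset_insert x X)

lemma insert_mem_attachAt (hv : v ⊆ X) (hX : X ∈ H) : insert x X ∈ attachAt x H v :=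
  Finset.mem_insert_of_mem (Finset.mem_image.2 ⟨X, hX, by simp [extendAbove, hv]⟩)

lemma singleton_mem_attachAt (hH : IsTreeFamily X H) {a : α} (ha : a ∈ insert x X)
    (hva : v ⊆ {a} → a = x) : {a} ∈ attachAt x H v := by
  rcases Finset.mem_insert.1 ha with rfl | ha
  · exact Finset.mem_insert_self _ _
  · by_cases h : v ⊆ {a}
    · rw [hva h]
      exact Finset.mem_insert_self _ _
    · exact Finset.mem_insert_of_mem
        (Finset.mem_image.2 ⟨{a}, hH.2.2.1 a ha, by simp only [extendAbove, h, if_false]⟩)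

lemma attachAt (hH : IsTreeFamily X H) (hx : x ∉ X) (hv : v ∈ H) (hcard : 2 ≤ v.card) :
    IsTreeFamily (insert x X) (attachAt x H v) := by
  refine ⟨hH.subset_nonempty_attachAt, insert_mem_attachAt (hH.1 v hv).1 hH.2.1,
    fun a ha => hH.singleton_mem_attachAt ha fun h => ?_, hH.laminar_attachAt hx hv⟩
  have := Finset.card_le_card h
  simp only [Finset.card_singleton] at this
  omega

lemma attachAbove (hH : IsTreeFamily X H) (hx : x ∉ X) (hv : v ∈ H) :
    IsTreeFamily (insert x X) (attachAbove x H v) := by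
  refine ⟨fun S hS => ?_, Finset.mem_insert_of_mem (insert_mem_attachAt (hH.1 v hv).1 hH.2.1),
    fun a ha => ?_, hH.laminar_attachAbove hx hv⟩
  · rcases Finset.mem_insert.1 hS with rfl | hS
    · exact ⟨(hH.1 S hv).1.trans (Finset.subset_insert x X), (hH.1 S hv).2⟩
    · exact hH.subset_nonempty_attachAt S hS
  · by_cases h : v ⊆ {a}
    · rw [← ((hH.1 v hv).2.subset_singleton_iff).1 h]
      exact Finset.mem_insert_self _ _
    · exact Finset.mem_insert_of_mem (hH.singleton_mem_attachAt ha fun h' => absurd h' h)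

lemma deleteLeaf_attachAt (hH : IsTreeFamily X H) (hx : x ∉ X) (v : Finset α) :
    deleteLeaf x (_root_.attachAt x H v) = H := by
  have h1 : (H.image (extendAbove x v)).image (fun S => S.erase x) = H := by
    rw [Finset.image_image]
    conv_rhs => rw [← Finset.image_id (s := H)]
    exact Finset.image_congr fun S hS => erase_extendAbove (hH.notMem hx hS)
  have h2 : ∅ ∉ H := fun h => by simpa using (hH.1 ∅ h).2
  rw [deleteLeaf, _root_.attachAt, Finset.image_insert, h1]
  simp [h2]

lemma deleteLeaf_attachAbove (hH : IsTreeFamily X H) (hx : x ∉ X) (hv : v ∈ H) :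
    deleteLeaf x (_root_.attachAbove x H v) = H := by
  have h := hH.deleteLeaf_attachAt hx v
  rw [deleteLeaf] at h
  have hne : v ≠ ∅ := (hH.1 v hv).2.ne_empty
  rw [deleteLeaf, _root_.attachAbove, Finset.image_insert,
    Finset.erase_eq_of_notMem (hH.notMem hx hv), Finset.erase_insert_of_ne hne, h,
    Finset.insert_eq_of_mem hv]

lemma isSibling_attachAt (hH : IsTreeFamily X H) (hx : x ∉ X) (hv : v ∈ H) :
    IsSibling x (_root_.attachAt x H v) v := by
  refine ⟨hH.notMem hx hv, (hH.1 v hv).2, Finset.mem_insert_of_mem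
    (Finset.mem_image.2 ⟨v, hv, by simp [extendAbove]⟩), ?_⟩
  simp only [_root_.attachAt, Finset.mem_insert, Finset.mem_image]
  rintro _ (rfl | ⟨S, hS, rfl⟩) hxS hne
  · exact absurd rfl hne
  · exact ((mem_extendAbove_iff (hH.notMem hx hS)).1 hxS).trans (subset_extendAbove x v S)

lemma isSibling_attachAbove (hH : IsTreeFamily X H) (hx : x ∉ X) (hv : v ∈ H) :
    IsSibling x (_root_.attachAbove x H v) v := by
  obtain ⟨h1, h2, h3, h4⟩ := hH.isSibling_attachAt hx hv
  refine ⟨h1, h2, Finset.mem_insert_of_mem h3, fun S hS hxS hne => ?_⟩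
  rcases Finset.mem_insert.1 hS with rfl | hS
  · exact subset_rfl
  · exact h4 S hS hxS hne

lemma exists_isSibling (hG : IsTreeFamily (insert x X) G) (hx : x ∉ X) (hX : X.Nonempty) :
    ∃ v, IsSibling x G v := by
  classical
  have hne : (G.filter fun S => x ∈ S ∧ S ≠ {x}).Nonempty := by
    refine ⟨insert x X, Finset.mem_filter.2 ⟨hG.2.1, Finset.mem_insert_self _ _, fun h => ?_⟩⟩
    obtain ⟨a, ha⟩ := hX
    have : a ∈ ({x} : Finset α) := h ▸ Finset.mem_insert_of_mem ha
    exact hx (Finset.mem_singleton.1 this ▸ ha)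
  obtain ⟨S, hS, hmin⟩ := Finset.exists_min_image _ Finset.card hne
  obtain ⟨hSG, hxS, hSx⟩ := Finset.mem_filter.1 hS
  refine ⟨S.erase x, Finset.notMem_erase x S, ?_, by rwa [Finset.insert_erase hxS], ?_⟩
  · rw [Finset.nonempty_iff_ne_empty, Ne, Finset.erase_eq_empty_iff]
    rintro (rfl | h)
    · simp at hxS
    · exact hSx h
  · intro T hT hxT hTx
    refine (Finset.erase_subset x S).trans ?_
    rcases hG.2.2.2 S hSG T hT with h | h | h
    · exact h
    · exact (Finset.eq_of_subset_of_card_le h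
        (hmin T (Finset.mem_filter.2 ⟨hT, hxT, hTx⟩))).ge
    · exact absurd hxT (Finset.disjoint_left.1 h hxS)

lemma deleteLeaf (hG : IsTreeFamily (insert x X) G) (hx : x ∉ X) (hX : X.Nonempty) :
    IsTreeFamily X (deleteLeaf x G) := by
  simp only [IsTreeFamily, _root_.deleteLeaf, Finset.mem_erase, Finset.mem_image]
  refine ⟨?_, ⟨hX.ne_empty, insert x X, hG.2.1, Finset.erase_insert hx⟩, fun a ha =>
    ⟨by simp, {a}, hG.2.2.1 a (Finset.mem_insert_of_mem ha), Finset.erase_eq_of_notMem ?_⟩, ?_⟩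
  · rintro _ ⟨hne, S, hS, rfl⟩
    exact ⟨Finset.subset_insert_iff.1 (hG.1 S hS).1, Finset.nonempty_iff_ne_empty.2 hne⟩
  · rw [Finset.mem_singleton]
    rintro rfl
    exact hx ha
  · rintro _ ⟨-, S, hS, rfl⟩ _ ⟨-, T, hT, rfl⟩
    rcases hG.2.2.2 S hS T hT with h | h | h
    · exact Or.inl (Finset.erase_subset_erase x h)
    · exact Or.inr (Or.inl (Finset.erase_subset_erase x h))
    · exact Or.inr (Or.inr (h.mono (Finset.erase_subset x S) (Finset.erase_subset x T)))

lemma sibling_mem_deleteLeaf (hv : IsSibling x G v) : v ∈ _root_.deleteLeaf x G :=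
  Finset.mem_erase.2 ⟨hv.2.1.ne_empty,
    Finset.mem_image.2 ⟨insert x v, hv.2.2.1, Finset.erase_insert hv.1⟩⟩

lemma eq_sibling (hG : IsTreeFamily (insert x X) G) (hv : IsSibling x G v) {S : Finset α}
    (hS : S ∈ G) (hxS : x ∉ S) (hvS : v ⊆ S) : S = v := by
  obtain ⟨-, ⟨a, ha⟩, hmem, -⟩ := hv
  rcases hG.2.2.2 S hS _ hmem with h | h | h
  · exact ((Finset.subset_insert_iff_of_notMem hxS).1 h).antisymm hvS
  · exact absurd (h (Finset.mem_insert_self _ _)) hxS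
  · exact absurd (Finset.mem_insert_of_mem ha) (Finset.disjoint_left.1 h (hvS ha))

lemma attachAt_deleteLeaf_subset (hG : IsTreeFamily (insert x X) G) (hv : IsSibling x G v) :
    _root_.attachAt x (_root_.deleteLeaf x G) v ⊆ G := by
  intro T hT
  simp only [_root_.attachAt, _root_.deleteLeaf, Finset.mem_insert, Finset.mem_image,
    Finset.mem_erase] at hT
  rcases hT with rfl | ⟨_, ⟨hne, S, hS, rfl⟩, rfl⟩
  · exact hG.2.2.1 x (Finset.mem_insert_self _ _)
  · unfold extendAbove
    by_cases hxS : x ∈ S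
    · have hSx : S ≠ {x} := by
        rintro rfl
        simp at hne
      rw [if_pos (Finset.subset_erase.2 ⟨hv.2.2.2 S hS hxS hSx, hv.1⟩), Finset.insert_erase hxS]
      exact hS
    · rw [Finset.erase_eq_of_notMem hxS]
      split_ifs with h
      · rw [hG.eq_sibling hv hS hxS h]
        exact hv.2.2.1
      · exact hS

lemma subset_attachAbove_deleteLeaf (hG : IsTreeFamily (insert x X) G) (hv : IsSibling x G v) :
    G ⊆ _root_.attachAbove x (_root_.deleteLeaf x G) v := by
  intro S hS
  simp only [_root_.attachAbove, _root_.attachAt, _root_.deleteLeaf, Finset.mem_insert,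
    Finset.mem_image, Finset.mem_erase]
  by_cases hxS : x ∈ S
  · by_cases hSx : S = {x}
    · exact Or.inr (Or.inl hSx)
    · have hsub := Finset.subset_erase.2 ⟨hv.2.2.2 S hS hxS hSx, hv.1⟩
      refine Or.inr (Or.inr ⟨S.erase x, ⟨(hv.2.1.mono hsub).ne_empty, S, hS, rfl⟩, ?_⟩)
      rw [extendAbove, if_pos hsub, Finset.insert_erase hxS]
  · by_cases h : v ⊆ S
    · exact Or.inl (hG.eq_sibling hv hS hxS h)
    · exact Or.inr (Or.inr ⟨S, ⟨(hG.1 S hS).2.ne_empty, S, hS, Finset.erase_eq_of_notMem hxS⟩,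
        if_neg h⟩)

lemma attachAbove_deleteLeaf (hG : IsTreeFamily (insert x X) G) (hv : IsSibling x G v)
    (hvG : v ∈ G) : _root_.attachAbove x (_root_.deleteLeaf x G) v = G :=
  (Finset.insert_subset hvG (hG.attachAt_deleteLeaf_subset hv)).antisymm
    (hG.subset_attachAbove_deleteLeaf hv)

lemma attachAt_deleteLeaf (hG : IsTreeFamily (insert x X) G) (hv : IsSibling x G v)
    (hvG : v ∉ G) : _root_.attachAt x (_root_.deleteLeaf x G) v = G :=
  (hG.attachAt_deleteLeaf_subset hv).antisymm
    ((Finset.subset_insert_iff_of_notMem hvG).1 (hG.subset_attachAbove_deleteLeaf hv))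

lemma card_filter_two_le (hH : IsTreeFamily X H) :
    (H.filter fun S => 2 ≤ S.card).card + X.card = H.card := by
  have h : H.filter (fun S => ¬ 2 ≤ S.card) = X.image singleton := by
    ext S
    simp only [Finset.mem_filter, Finset.mem_image]
    constructor
    · rintro ⟨hS, hc⟩
      have := (hH.1 S hS).2.card_pos
      obtain ⟨a, rfl⟩ := Finset.card_eq_one.1 (show S.card = 1 by omega)
      exact ⟨a, (hH.1 _ hS).1 (Finset.mem_singleton_self a), rfl⟩
    · rintro ⟨a, ha, rfl⟩
      exact ⟨hH.2.2.1 a ha, by simp⟩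
  rw [← Finset.card_image_of_injective X (Finset.singleton_injective), ← h,
    Finset.card_filter_add_card_filter_not]

end IsTreeFamily

open Classical in
lemma card_treeFamilies_sibling_notMem {X : Finset α} {x : α} (hx : x ∉ X) (hX : X.Nonempty)
    (p : ℕ) :
    ((treeFamilies (insert x X) (p + 1)).filter fun G => ∀ v, IsSibling x G v → v ∉ G).card =
      (p - X.card) * (treeFamilies X p).card := by
  have hcard : ((treeFamilies X p).sigma fun H => H.filter fun S => 2 ≤ S.card).card =
      (p - X.card) * (treeFamilies X p).card := by
    rw [Finset.card_sigma, mul_comm]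
    refine Finset.sum_const_nat fun H hH => ?_
    obtain ⟨hH, hp⟩ := mem_treeFamilies.1 hH
    have := hH.card_filter_two_le
    omega
  rw [← hcard]
  refine (Finset.card_bij (fun q _ => attachAt x q.1 q.2) ?_ ?_ ?_).symm
  · rintro ⟨H, v⟩ hq
    simp only [Finset.mem_sigma, Finset.mem_filter, mem_treeFamilies] at hq ⊢
    obtain ⟨⟨hH, rfl⟩, hv, hc⟩ := hq
    refine ⟨⟨hH.attachAt hx hv hc, hH.card_attachAt hx v⟩, fun w hw => ?_⟩
    rw [hw.unique (hH.isSibling_attachAt hx hv)]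
    exact hH.notMem_attachAt hx hv
  · rintro ⟨H, v⟩ hq ⟨H', v'⟩ hq' h
    simp only [Finset.mem_sigma, Finset.mem_filter, mem_treeFamilies] at hq hq' h
    have h1 : H = H' := by
      rw [← hq.1.1.deleteLeaf_attachAt hx v, h, hq'.1.1.deleteLeaf_attachAt hx]
    have h2 : v = v' := (hq.1.1.isSibling_attachAt hx hq.2.1).unique
      (h ▸ hq'.1.1.isSibling_attachAt hx hq'.2.1)
    rw [h1, h2]
  · intro G hG
    simp only [Finset.mem_filter, mem_treeFamilies] at hG
    obtain ⟨⟨hG, hp⟩, hnot⟩ := hG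
    obtain ⟨v, hv⟩ := hG.exists_isSibling hx hX
    have hD := hG.deleteLeaf hx hX
    have hvD := IsTreeFamily.sibling_mem_deleteLeaf hv
    have heq := hG.attachAt_deleteLeaf hv (hnot v hv)
    have hc := hD.card_attachAt hx v
    rw [heq, hp] at hc
    refine ⟨⟨deleteLeaf x G, v⟩, ?_, heq⟩
    simp only [Finset.mem_sigma, Finset.mem_filter, mem_treeFamilies]
    refine ⟨⟨hD, by omega⟩, hvD, ?_⟩
    by_contra hlt
    have := hv.2.1.card_pos
    obtain ⟨a, rfl⟩ := Finset.card_eq_one.1 (show v.card = 1 by omega)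
    exact hnot _ hv (hG.2.2.1 a (Finset.mem_insert_of_mem
      ((hD.1 _ hvD).1 (Finset.mem_singleton_self a))))

open Classical in
lemma card_treeFamilies_sibling_mem {X : Finset α} {x : α} (hx : x ∉ X) (hX : X.Nonempty)
    (p : ℕ) :
    ((treeFamilies (insert x X) (p + 2)).filter fun G => ¬ ∀ v, IsSibling x G v → v ∉ G).card =
      p * (treeFamilies X p).card := by
  have hcard : ((treeFamilies X p).sigma fun H => H).card = p * (treeFamilies X p).card := by
    rw [Finset.card_sigma, mul_comm]
    exact Finset.sum_const_nat fun H hH => (mem_treeFamilies.1 hH).2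
  rw [← hcard]
  refine (Finset.card_bij (fun q _ => attachAbove x q.1 q.2) ?_ ?_ ?_).symm
  · rintro ⟨H, v⟩ hq
    simp only [Finset.mem_sigma, Finset.mem_filter, mem_treeFamilies] at hq ⊢
    obtain ⟨⟨hH, rfl⟩, hv⟩ := hq
    exact ⟨⟨hH.attachAbove hx hv, hH.card_attachAbove hx hv⟩,
      fun h => h v (hH.isSibling_attachAbove hx hv) (Finset.mem_insert_self _ _)⟩
  · rintro ⟨H, v⟩ hq ⟨H', v'⟩ hq' h
    simp only [Finset.mem_sigma, mem_treeFamilies] at hq hq' h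
    have h1 : H = H' := by
      rw [← hq.1.1.deleteLeaf_attachAbove hx hq.2, h, hq'.1.1.deleteLeaf_attachAbove hx hq'.2]
    have h2 : v = v' := (hq.1.1.isSibling_attachAbove hx hq.2).unique
      (h ▸ hq'.1.1.isSibling_attachAbove hx hq'.2)
    rw [h1, h2]
  · intro G hG
    simp only [Finset.mem_filter, mem_treeFamilies] at hG
    obtain ⟨⟨hG, hp⟩, hex⟩ := hG
    push Not at hex
    obtain ⟨v, hv, hvG⟩ := hex
    have hD := hG.deleteLeaf hx hX
    have hvD := IsTreeFamily.sibling_mem_deleteLeaf hv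
    have heq := hG.attachAbove_deleteLeaf hv hvG
    have hc := hD.card_attachAbove hx hvD
    rw [heq, hp] at hc
    have hc' : (deleteLeaf x G).card = p := by omega
    exact ⟨⟨deleteLeaf x G, v⟩, Finset.mem_sigma.2 ⟨mem_treeFamilies.2 ⟨hD, hc'⟩, hvD⟩, heq⟩

lemma card_treeFamilies_insert {X : Finset α} {x : α} (hx : x ∉ X) (hX : X.Nonempty) (p : ℕ) :
    (treeFamilies (insert x X) (p + 2)).card =
      (p + 1 - X.card) * (treeFamilies X (p + 1)).card + p * (treeFamilies X p).card := by
  classical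
  rw [← card_treeFamilies_sibling_notMem hx hX, ← card_treeFamilies_sibling_mem hx hX,
    Finset.card_filter_add_card_filter_not]

end LeafInsertion

/-- The faces of the Whitehouse complex are the sets of inner non-root nodes of trees. -/
lemma whfc_eq_card_treeFamilies {n : ℕ} (hn : 3 ≤ n) (j : ℕ) :
    whfc n j = (treeFamilies (Finset.Icc 2 n) (n + j)).card := by
  classical
  set X := Finset.Icc 2 n with hXdef
  have hXc : X.card = n - 1 := by simp [hXdef]
  set leaves : Finset (Finset ℕ) := X.image singleton with hleaves
  have hlc : leaves.card = n - 1 := by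
    rw [hleaves, Finset.card_image_of_injective _ Finset.singleton_injective, hXc]
  have hl1 : ∀ S ∈ leaves, S.card = 1 := by
    intro S hS
    obtain ⟨a, -, rfl⟩ := Finset.mem_image.1 hS
    simp
  have hXl : X ∉ leaves := fun h => by
    have := hl1 X h
    omega
  have hXne : X.Nonempty := Finset.card_pos.1 (by omega)
  have hcard : ∀ F : Finset (Finset ℕ), (∀ S ∈ F, 2 ≤ S.card ∧ S.card ≤ n - 2) →
      (F ∪ insert X leaves).card = n + F.card := by
    intro F hF
    rw [Finset.card_union_of_disjoint, Finset.card_insert_of_notMem hXl, hlc]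
    · omega
    · rw [Finset.disjoint_left]
      intro S hS hS'
      have h := hF S hS
      rcases Finset.mem_insert.1 hS' with rfl | hS'
      · omega
      · have := hl1 S hS'
        omega
  have hfilter : ∀ F : Finset (Finset ℕ), (∀ S ∈ F, 2 ≤ S.card ∧ S.card ≤ n - 2) →
      (F ∪ insert X leaves).filter (fun S => 2 ≤ S.card ∧ S.card ≤ n - 2) = F := by
    intro F hF
    ext S
    simp only [Finset.mem_filter, Finset.mem_union, Finset.mem_insert]
    constructor
    · rintro ⟨h | rfl | h, hc⟩
      · exact h
      · omega
      · have := hl1 S h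
        omega
    · exact fun h => ⟨Or.inl h, hF S h⟩
  have hunion : ∀ G, IsTreeFamily X G →
      G.filter (fun S => 2 ≤ S.card ∧ S.card ≤ n - 2) ∪ insert X leaves = G := by
    intro G hG
    ext S
    simp only [Finset.mem_filter, Finset.mem_union, Finset.mem_insert, hleaves, Finset.mem_image]
    constructor
    · rintro (h | rfl | ⟨a, ha, rfl⟩)
      · exact h.1
      · exact hG.2.1
      · exact hG.2.2.1 a ha
    · intro hS
      by_cases hc : 2 ≤ S.card ∧ S.card ≤ n - 2
      · exact Or.inl ⟨hS, hc⟩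
      right
      obtain ⟨hSX, hne⟩ := hG.1 S hS
      by_cases h1 : S.card = 1
      · obtain ⟨a, rfl⟩ := Finset.card_eq_one.1 h1
        exact Or.inr ⟨a, hSX (Finset.mem_singleton_self a), rfl⟩
      · have := hne.card_pos
        exact Or.inl (Finset.eq_of_subset_of_card_le hSX (by omega))
  rw [whfc, ← Set.ncard_coe_finset]
  refine Set.ncard_congr (fun F _ => F ∪ insert X leaves) ?_ ?_ ?_
  · rintro F ⟨⟨hF, hlam⟩, rfl⟩
    refine mem_treeFamilies.2 ⟨⟨?_, by simp, fun a ha => ?_, ?_⟩, hcard F fun S hS => (hF S hS).2⟩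
    · simp only [Finset.mem_union, Finset.mem_insert, hleaves, Finset.mem_image]
      rintro S (h | rfl | ⟨a, ha, rfl⟩)
      · have := (hF S h).2.1
        exact ⟨(hF S h).1, Finset.card_pos.1 (by omega)⟩
      · exact ⟨subset_rfl, hXne⟩
      · simpa using ha
    · simp [hleaves, ha]
    · have hX : ∀ S ∈ F ∪ insert X leaves, S ⊆ X := by
        simp only [Finset.mem_union, Finset.mem_insert, hleaves, Finset.mem_image]
        rintro S (h | rfl | ⟨a, ha, rfl⟩)
        · exact (hF S h).1
        · exact subset_rfl
        · simpa using ha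
      have hsing : ∀ (a : ℕ) (T : Finset ℕ), {a} ⊆ T ∨ Disjoint {a} T := by
        intro a T
        simp [em]
      intro S hS T hT
      have hSX := hX S hS
      have hTX := hX T hT
      simp only [Finset.mem_union, Finset.mem_insert, hleaves, Finset.mem_image] at hS hT
      rcases hS with hS | rfl | ⟨a, -, rfl⟩
      · rcases hT with hT | rfl | ⟨a, -, rfl⟩
        · simpa only [Finset.disjoint_iff_inter_eq_empty] using hlam S hS T hT
        · exact Or.inl hSX
        · rcases hsing a S with h | h
          · exact Or.inr (Or.inl h)
          · exact Or.inr (Or.inr h.symm)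
      · exact Or.inr (Or.inl hTX)
      · rcases hsing a T with h | h
        · exact Or.inl h
        · exact Or.inr (Or.inr h)
  · rintro F F' ⟨⟨hF, -⟩, -⟩ ⟨⟨hF', -⟩, -⟩ h
    rw [← hfilter F fun S hS => (hF S hS).2, h, hfilter F' fun S hS => (hF' S hS).2]
  · intro G hG
    obtain ⟨hG, hp⟩ := mem_treeFamilies.1 hG
    have hc := hcard (G.filter fun S => 2 ≤ S.card ∧ S.card ≤ n - 2)
      fun S hS => (Finset.mem_filter.1 hS).2
    rw [hunion G hG, hp] at hc
    refine ⟨_, ⟨⟨fun S hS => ?_, fun S hS T hT => ?_⟩, by omega⟩, hunion G hG⟩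
    · obtain ⟨hS, hS'⟩ := Finset.mem_filter.1 hS
      exact ⟨(hG.1 S hS).1, hS'⟩
    · simpa only [Finset.disjoint_iff_inter_eq_empty] using
        hG.2.2.2 S (Finset.mem_filter.1 hS).1 T (Finset.mem_filter.1 hT).1

lemma whfc_zero (n : ℕ) : whfc n 0 = 1 := by
  rw [whfc, Set.ncard_eq_one]
  refine ⟨∅, Set.eq_singleton_iff_unique_mem.2 ⟨by simp [IsWhFace], fun F hF => ?_⟩⟩
  exact Finset.card_eq_zero.1 hF.2

lemma whfc_succ {n : ℕ} (hn : 3 ≤ n) (j : ℕ) :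
    whfc (n + 1) (j + 1) = (j + 2) * whfc n (j + 1) + (n + j) * whfc n j := by
  have hI : Finset.Icc 2 (n + 1) = insert (n + 1) (Finset.Icc 2 n) := by
    ext a
    simp only [Finset.mem_Icc, Finset.mem_insert]
    omega
  rw [whfc_eq_card_treeFamilies (by omega), whfc_eq_card_treeFamilies hn,
    whfc_eq_card_treeFamilies hn, hI, show n + 1 + (j + 1) = n + j + 2 by ring,
    card_treeFamilies_insert (by simp) ⟨2, by simp; omega⟩, Nat.card_Icc,
    show n + j + 1 - (n + 1 - 2) = j + 2 by omega, add_assoc n j 1]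

lemma whfc_eq_zero {n j : ℕ} (hn : 3 ≤ n) (hj : n - 3 < j) : whfc n j = 0 := by
  induction n, hn using Nat.le_induction generalizing j with
  | base =>
    have : {F : Finset (Finset ℕ) | IsWhFace 3 F ∧ F.card = j} = ∅ := by
      refine Set.eq_empty_of_forall_notMem fun F ⟨⟨hF, _⟩, hc⟩ => ?_
      obtain ⟨S, hS⟩ := Finset.card_pos.1 (show 0 < F.card by omega)
      have := hF S hS
      omega
    rw [whfc, this, Set.ncard_empty]
  | succ n hn ih =>
    obtain ⟨j, rfl⟩ : ∃ i, j = i + 1 := ⟨j - 1, by omega⟩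
    rw [whfc_succ hn, ih (by omega), ih (by omega), mul_zero, mul_zero, add_zero]

/-- The sum defining `h_{n,k}` vanishes for `k > n - 3`, in accordance with the convention. -/
lemma whh_natCast {n k : ℕ} (hn : 3 ≤ n) :
    whh n k = ∑ i ∈ Finset.range (k + 1),
      (-1 : ℤ) ^ (k - i) * (Nat.choose (n - 3 - i) (k - i)) * whfc n i := by
  rw [whh]
  split_ifs with h
  · simp
  · refine (Finset.sum_eq_zero fun i hi => ?_).symm
    have hi := Finset.mem_range.1 hi
    rcases Nat.lt_or_ge (n - 3) i with h' | h'
    · simp [whfc_eq_zero hn h']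
    · rw [Nat.choose_eq_zero_of_lt (by omega)]
      simp

lemma choose_identity {a b : ℕ} (i : ℤ) (hb : b ≤ a) :
    (Nat.choose (a + 1) (b + 1) : ℤ) * (i + 1) - Nat.choose a b * (a + 1 + i + i + 2) =
      (b + 1 + i + 1) * Nat.choose a (b + 1) -
        (2 * (a + 1 + i) + 1 - (b + 1 + i)) * Nat.choose a b := by
  have h : (Nat.choose a (b + 1) : ℤ) * (b + 1) = Nat.choose a b * (a - b) := by
    have := Nat.choose_succ_right_eq a b
    zify [hb] at this
    exact this
  rw [Nat.choose_succ_succ]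
  push_cast
  linear_combination -h

theorem stmt6 (n : ℕ) (hn : 4 ≤ n) :
    ∀ k : ℤ, 0 ≤ k → k ≤ (n : ℤ) - 3 →
      whh n k = (k + 1) * whh (n - 1) k + (2 * (n : ℤ) - k - 5) * whh (n - 1) (k - 1) := by
  intro k hk0 hk
  lift k to ℕ using hk0
  obtain ⟨d, rfl⟩ : ∃ d, n = d + 4 := ⟨n - 4, by omega⟩
  simp only [show d + 4 - 1 = d + 3 by omega]
  rw [whh_natCast (by omega), whh_natCast (by omega)]
  rcases k with _ | k
  · simp [whfc_zero, whh]
  rw [show ((k + 1 : ℕ) : ℤ) - 1 = (k : ℕ) by push_cast; ring,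
    whh_natCast (by omega)]
  have hrec : ∀ i : ℕ, (whfc (d + 4) (i + 1) : ℤ) =
      (i + 2) * whfc (d + 3) (i + 1) + (d + 3 + i) * whfc (d + 3) i := by
    intro i
    exact_mod_cast whfc_succ (n := d + 3) (by omega) i
  have hsplit : ∑ i ∈ Finset.range (k + 1 + 1),
      (-1 : ℤ) ^ (k + 1 - i) * (Nat.choose (d + 4 - 3 - i) (k + 1 - i)) * whfc (d + 4) i =
      ∑ i ∈ Finset.range (k + 1 + 1), (-1 : ℤ) ^ (k + 1 - i) *
        (Nat.choose (d + 1 - i) (k + 1 - i)) * ((i + 1) * whfc (d + 3) i) +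
      ∑ i ∈ Finset.range (k + 1), (-1 : ℤ) ^ (k - i) *
        (Nat.choose (d - i) (k - i)) * ((d + 3 + i) * whfc (d + 3) i) := by
    rw [Finset.sum_range_succ', Finset.sum_range_succ' _ (k + 1), add_right_comm,
      ← Finset.sum_add_distrib]
    congr 1
    · refine Finset.sum_congr rfl fun i _ => ?_
      rw [hrec, show k + 1 - (i + 1) = k - i by omega,
        show d + 4 - 3 - (i + 1) = d - i by omega, show d + 1 - (i + 1) = d - i by omega]
      push_cast
      ring
    · simp [whfc_zero]
  rw [hsplit, Finset.sum_range_succ, Finset.sum_range_succ _ (k + 1), mul_add, Finset.mul_sum,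
    Finset.mul_sum, add_right_comm, ← Finset.sum_add_distrib, add_right_comm,
    ← Finset.sum_add_distrib]
  congr 1
  · refine Finset.sum_congr rfl fun i hi => ?_
    have hi := Finset.mem_range.1 hi
    obtain ⟨b, rfl⟩ : ∃ b, k = i + b := ⟨k - i, by omega⟩
    obtain ⟨a, rfl⟩ : ∃ a, d = i + a := ⟨d - i, by omega⟩
    have h := choose_identity (a := a) (b := b) i (by omega)
    rw [show i + a + 1 - i = a + 1 by omega, show i + b + 1 - i = b + 1 by omega,
      show i + a + 3 - 3 - i = a by omega, show i + a - i = a by omega,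
      show i + b - i = b by omega]
    push_cast
    linear_combination (-1 : ℤ) ^ (b + 1) * (whfc (i + a + 3) i : ℤ) * h
  · simp
end

section
/- Let P be a finite graded poset with rank function ρ and let M be a matching on P, i.e., a set of pairwise disjoint two-element sets {x,y} with x ⋖ y a cover relation of P. Form the directed graph on P whose edges are x → y for every cover relation y ⋖ x with {y,x} ∉ M, together with x → y for every cover relation x ⋖ y with {x,y} ∈ M. Then this directed graph is acyclic if and only if for every i, the induced directed subgraph on the set of M-matched elements of ranks i and i+1 is acyclic; equivalently, every directed cycle has all of its elements matched by M and lying in two adjacent ranks, with its edges alternately pointing upwards and downwards. -/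
/-- The directed graph associated to a matching `M` on a poset `P`: every cover edge of
the Hasse diagram is oriented downwards, except that the edges of `M` are oriented
upwards. -/
def MorseRel {P : Type*} [PartialOrder P] (M : Finset (P × P)) (x y : P) : Prop :=
  (y ⋖ x ∧ (y, x) ∉ M) ∨ (x ⋖ y ∧ (x, y) ∈ M)

/-- `x` is matched by the matching `M`. -/
def IsMatched {P : Type*} (M : Finset (P × P)) (x : P) : Prop :=
  ∃ p ∈ M, x = p.1 ∨ x = p.2

/-- If `f` does not increase along `r`, then an `r`-path whose endpoints have the same value
under `f` stays in one level set of `f`. -/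
theorem transGen_level_of_antitone {α β : Type*} [PartialOrder β] {r : α → α → Prop} (f : α → β)
    (hf : ∀ x y, r x y → f y ≤ f x) {a b : α} (h : Relation.TransGen r a b) (hab : f a = f b) :
    Relation.TransGen (fun x y => r x y ∧ f x = f a ∧ f y = f a) a b := by
  have anti : ∀ {c}, Relation.TransGen r a c → f c ≤ f a := by
    intro c hc
    induction hc with
    | single h => exact hf _ _ h
    | tail _ h ih => exact (hf _ _ h).trans ih
  induction h with
  | single h => exact .single ⟨h, rfl, hab.symm⟩
  | tail hc h ih =>
    have hca := le_antisymm (anti hc) (hab.trans_le (hf _ _ h))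
    exact .tail (ih hca.symm) ⟨h, hca, hab.symm⟩

open Classical in
/-- Twice the rank, shifted so that both ends of an edge of `M` receive the same value. -/
noncomputable def morsePotential {P : Type*} (ρ : P → ℕ) (M : Finset (P × P)) (x : P) : ℕ :=
  2 * ρ x + if ∃ y, (x, y) ∈ M then 2 else if ∃ y, (y, x) ∈ M then 0 else 1

/-- The potential does not increase along the directed graph of a matching, and an edge which
preserves it joins matched elements in the two adjacent ranks determined by its value. -/
theorem MorseRel.potential_le {P : Type*} [PartialOrder P] {ρ : P → ℕ} {M : Finset (P × P)}
    (hgrade : ∀ x y : P, x ⋖ y → ρ y = ρ x + 1)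
    (hchain : ∀ x y z : P, (x, y) ∈ M → (y, z) ∉ M) {x y : P} (h : MorseRel M x y) :
    morsePotential ρ M y ≤ morsePotential ρ M x ∧
      (morsePotential ρ M x = morsePotential ρ M y →
        IsMatched M x ∧ IsMatched M y ∧
        (ρ x = morsePotential ρ M x / 2 - 1 ∨ ρ x = morsePotential ρ M x / 2 - 1 + 1) ∧
        (ρ y = morsePotential ρ M x / 2 - 1 ∨ ρ y = morsePotential ρ M x / 2 - 1 + 1)) := by
  obtain ⟨hyx, -⟩ | ⟨hxy, hM⟩ := h
  · have hr := hgrade _ _ hyx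
    unfold morsePotential
    split_ifs <;> refine ⟨by omega, fun he => ?_⟩ <;>
      try omega
    obtain ⟨z, hz⟩ : ∃ z, (z, x) ∈ M := by assumption
    obtain ⟨w, hw⟩ : ∃ w, (y, w) ∈ M := by assumption
    exact ⟨⟨_, hz, .inr rfl⟩, ⟨_, hw, .inl rfl⟩, by omega, by omega⟩
  · have hr := hgrade _ _ hxy
    have hx : morsePotential ρ M x = 2 * ρ x + 2 := by
      simp [morsePotential, show ∃ z, (x, z) ∈ M from ⟨y, hM⟩]
    have hy : morsePotential ρ M y = 2 * ρ y := by
      simp [morsePotential, hchain x y _ hM, show ∃ z, (z, y) ∈ M from ⟨x, hM⟩]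
    exact ⟨by omega, fun _ => ⟨⟨_, hM, .inl rfl⟩, ⟨_, hM, .inr rfl⟩, by omega, by omega⟩⟩

/-- For a matching `M` on a finite graded poset `P`, the directed graph obtained by
orienting cover edges downwards and the edges of `M` upwards is acyclic if and only if,
for every `i`, the induced directed subgraph on the `M`-matched elements of ranks `i`
and `i+1` is acyclic. -/
theorem stmt7 {P : Type*} [Fintype P] [PartialOrder P] [DecidableEq P]
    (ρ : P → ℕ) (hgrade : ∀ x y : P, x ⋖ y → ρ y = ρ x + 1)
    (M : Finset (P × P))
    (hcov : ∀ p ∈ M, p.1 ⋖ p.2)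
    (hdisj : ∀ p ∈ M, ∀ q ∈ M, p ≠ q →
      p.1 ≠ q.1 ∧ p.1 ≠ q.2 ∧ p.2 ≠ q.1 ∧ p.2 ≠ q.2) :
    (¬ ∃ x : P, Relation.TransGen (MorseRel M) x x) ↔
      (∀ i : ℕ, ¬ ∃ x : P, Relation.TransGen
        (fun x y => MorseRel M x y ∧ IsMatched M x ∧ IsMatched M y ∧
          (ρ x = i ∨ ρ x = i + 1) ∧ (ρ y = i ∨ ρ y = i + 1)) x x) := by
  constructor
  · rintro h i ⟨x, hx⟩
    exact h ⟨x, Relation.TransGen.mono (fun _ _ hr => hr.1) _ _ hx⟩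
  · rintro h ⟨x, hx⟩
    have hchain : ∀ x y z : P, (x, y) ∈ M → (y, z) ∉ M := fun x y z hxy hyz =>
      (hdisj _ hxy _ hyz fun he => (hcov _ hxy).ne (Prod.ext_iff.mp he).1).2.2.1 rfl
    have key := transGen_level_of_antitone (morsePotential ρ M)
      (fun _ _ hr => (hr.potential_le hgrade hchain).1) hx rfl
    refine h (morsePotential ρ M x / 2 - 1) ⟨x, Relation.TransGen.mono (fun u v hr => ?_) _ _ key⟩
    obtain ⟨huv, hu, hv⟩ := hr
    have hlevel := (huv.potential_le hgrade hchain).2 (hu.trans hv.symm)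
    rw [hu] at hlevel
    exact ⟨huv, hlevel⟩
end

section
/- Let P be a finite graded poset which is the disjoint union of a lower order ideal L and an upper order ideal U. If M₁ is a Morse matching of L (all its pairs lying in L) and M₂ is a Morse matching of U (all its pairs lying in U), then M₁ ∪ M₂ is a Morse matching of P; that is, the directed graph on P obtained by orienting all cover edges downwards and then reversing the edges of M₁ ∪ M₂ is acyclic. -/
/-- A path starting in a set that is closed under `r` stays in that set. -/
theorem transGen_restrict_of_closed {α : Type*} {r : α → α → Prop} {S : Set α}
    (hS : ∀ x y, r x y → x ∈ S → y ∈ S) {a b : α} (h : Relation.TransGen r a b) (ha : a ∈ S) :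
    Relation.TransGen (fun x y => r x y ∧ x ∈ S ∧ y ∈ S) a b ∧ b ∈ S := by
  induction h with
  | single hab => exact ⟨.single ⟨hab, ha, hS _ _ hab ha⟩, hS _ _ hab ha⟩
  | tail _ hbc ih => exact ⟨ih.1.tail ⟨hbc, ih.2, hS _ _ hbc ih.2⟩, hS _ _ hbc ih.2⟩

/-- A path ending in a set that is closed under the reverse of `r` comes from that set. -/
theorem transGen_restrict_of_coclosed {α : Type*} {r : α → α → Prop} {S : Set α}
    (hS : ∀ x y, r x y → y ∈ S → x ∈ S) {a b : α} (h : Relation.TransGen r a b) (hb : b ∈ S) :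
    Relation.TransGen (fun x y => r x y ∧ x ∈ S ∧ y ∈ S) a b := by
  induction h with
  | single hab => exact .single ⟨hab, hS _ _ hab hb, hb⟩
  | tail _ hbc ih => exact (ih (hS _ _ hbc hb)).tail ⟨hbc, hS _ _ hbc hb, hb⟩

theorem MorseRel.left_of_union {P : Type*} [PartialOrder P] [DecidableEq P]
    {M N : Finset (P × P)} {x y : P} (h : MorseRel (M ∪ N) x y) (hN : (x, y) ∉ N) :
    MorseRel M x y := by
  simp only [MorseRel, Finset.mem_union] at *
  tauto

/-- Let the finite graded poset `P` be the disjoint union of a lower order ideal `L` and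
an upper order ideal `U`.  If `M₁` is a Morse matching of `L` and `M₂` is a Morse
matching of `U`, then `M₁ ∪ M₂` is a Morse matching of `P`. -/
theorem stmt8 {P : Type*} [Fintype P] [PartialOrder P] [DecidableEq P]
    (ρ : P → ℕ) (hgrade : ∀ x y : P, x ⋖ y → ρ y = ρ x + 1)
    (L U : Set P)
    (hpart : ∀ x : P, (x ∈ L ∧ x ∉ U) ∨ (x ∉ L ∧ x ∈ U))
    (hL : ∀ x y : P, x ≤ y → y ∈ L → x ∈ L)
    (hU : ∀ x y : P, x ≤ y → x ∈ U → y ∈ U)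
    (M₁ M₂ : Finset (P × P))
    (hcov₁ : ∀ p ∈ M₁, p.1 ⋖ p.2) (hin₁ : ∀ p ∈ M₁, p.1 ∈ L ∧ p.2 ∈ L)
    (hdisj₁ : ∀ p ∈ M₁, ∀ q ∈ M₁, p ≠ q →
      p.1 ≠ q.1 ∧ p.1 ≠ q.2 ∧ p.2 ≠ q.1 ∧ p.2 ≠ q.2)
    (hacyc₁ : ¬ ∃ x : P, Relation.TransGen
      (fun x y => MorseRel M₁ x y ∧ x ∈ L ∧ y ∈ L) x x)
    (hcov₂ : ∀ p ∈ M₂, p.1 ⋖ p.2) (hin₂ : ∀ p ∈ M₂, p.1 ∈ U ∧ p.2 ∈ U)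
    (hdisj₂ : ∀ p ∈ M₂, ∀ q ∈ M₂, p ≠ q →
      p.1 ≠ q.1 ∧ p.1 ≠ q.2 ∧ p.2 ≠ q.1 ∧ p.2 ≠ q.2)
    (hacyc₂ : ¬ ∃ x : P, Relation.TransGen
      (fun x y => MorseRel M₂ x y ∧ x ∈ U ∧ y ∈ U) x x) :
    ¬ ∃ x : P, Relation.TransGen (MorseRel (M₁ ∪ M₂)) x x := by
  rintro ⟨x, hx⟩
  have not_mem_U : ∀ x, x ∈ L → x ∉ U := fun x hx hxU => by
    rcases hpart x with h | h
    exacts [h.2 hxU, h.1 hx]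
  rcases hpart x with ⟨hxL, -⟩ | ⟨-, hxU⟩
  · have hclosed : ∀ a b, MorseRel (M₁ ∪ M₂) a b → a ∈ L → b ∈ L := by
      rintro a b (⟨hba, -⟩ | ⟨-, hab⟩) ha
      · exact hL b a hba.le ha
      · rcases Finset.mem_union.1 hab with h | h
        · exact (hin₁ _ h).2
        · exact absurd (hin₂ _ h).1 (not_mem_U a ha)
    refine hacyc₁ ⟨x, Relation.TransGen.mono ?_ _ _ (transGen_restrict_of_closed hclosed hx hxL).1⟩
    rintro a b ⟨hab, ha, hb⟩
    exact ⟨hab.left_of_union fun h => not_mem_U a ha (hin₂ _ h).1, ha, hb⟩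
  · have hcoclosed : ∀ a b, MorseRel (M₁ ∪ M₂) a b → b ∈ U → a ∈ U := by
      rintro a b (⟨hba, -⟩ | ⟨-, hab⟩) hb
      · exact hU b a hba.le hb
      · rcases Finset.mem_union.1 hab with h | h
        · exact absurd hb (not_mem_U b (hin₁ _ h).2)
        · exact (hin₂ _ h).1
    refine hacyc₂ ⟨x, Relation.TransGen.mono ?_ _ _ (transGen_restrict_of_coclosed hcoclosed hx hxU)⟩
    rintro a b ⟨hab, ha, hb⟩
    rw [Finset.union_comm] at hab
    exact ⟨hab.left_of_union fun h => not_mem_U a (hin₁ _ h).1 ha, ha, hb⟩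
end
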